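/- Every caterpillar with at least three edges is arithmetic product antimagic. -/

import Mathlib

open scoped Classical

noncomputable def edgeFS {V : Type*} [Fintype V] (G : SimpleGraph V) : Finset (Sym2 V) :=
  G.edgeSet.toFinset

noncomputable def vSum {V : Type*} [Fintype V] (G : SimpleGraph V) (φ : Sym2 V → ℝ) (v : V) : ℝ :=
  ∑ e ∈ (edgeFS G).filter (fun e => v ∈ e), φ e

noncomputable def vProd {V : Type*} [Fintype V] (G : SimpleGraph V) (φ : Sym2 V → ℝ) (v : V) : ℝ :=
  ∏ e ∈ (edgeFS G).filter (fun e => v ∈ e), φ e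

/-- `G` admits a product antimagic `L`-labeling for every strictly increasing arithmetic
sequence `L` of reals, all at least `1`, of length `(edgeFS G).card`. -/
def ArithProdAntimagic {V : Type*} [Fintype V] (G : SimpleGraph V) : Prop :=
  ∀ a d : ℝ, 1 ≤ a → 0 < d →
    ∃ φ : Sym2 V → ℝ,
      Set.BijOn φ ↑(edgeFS G)
        ↑((Finset.range (edgeFS G).card).image (fun i : ℕ => a + (i : ℝ) * d)) ∧
      Function.Injective (vProd G φ)

/-- A caterpillar: a tree in which removing all vertices of degree one yields a path
(possibly empty). -/
def IsCaterpillar {V : Type*} [Fintype V] (T : SimpleGraph V) : Prop :=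
  T.IsTree ∧ ∃ k : ℕ,
    Nonempty ((SimpleGraph.induce {v : V | T.degree v ≠ 1} T) ≃g SimpleGraph.pathGraph k)

/-- The `n`-th term of the arithmetic sequence with first term `a` and difference `d`. -/
noncomputable def aseq (a d : ℝ) (n : ℕ) : ℝ := a + n * d

section aseq

variable {a d : ℝ}

lemma aseq_zero : aseq a d 0 = a := by simp [aseq]

lemma aseq_succ (n : ℕ) : aseq a d (n + 1) = aseq a d n + d := by
  simp [aseq]; ring

lemma aseq_strictMono (hd : 0 < d) : StrictMono (aseq a d) :=
  strictMono_nat_of_lt_succ fun n => by rw [aseq_succ]; linarith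

lemma le_aseq (hd : 0 < d) (n : ℕ) : a ≤ aseq a d n := by
  have : (0 : ℝ) ≤ n * d := by positivity
  simp only [aseq]; linarith

lemma one_lt_aseq (ha : 1 < a) (hd : 0 < d) (n : ℕ) : 1 < aseq a d n :=
  ha.trans_le (le_aseq hd n)

lemma aseq_mul_lt (ha : 1 < a) (hd : 0 < d) {u u' v v' : ℕ} (hu : u ≤ u') (hv : v ≤ v')
    (h : u ≠ u' ∨ v ≠ v') :
    aseq a d u * aseq a d v + d < aseq a d u' * aseq a d v' := by
  have key : ∀ {u u' v v' : ℕ}, u < u' → v ≤ v' →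
      aseq a d u * aseq a d v + d < aseq a d u' * aseq a d v' := by
    intro u u' v v' hu hv
    have h1 : aseq a d u + d ≤ aseq a d u' := by
      rw [← aseq_succ]; exact (aseq_strictMono hd).monotone hu
    have h2 := (aseq_strictMono (a := a) hd).monotone hv
    have h3 := one_lt_aseq ha hd v
    have h4 := one_lt_aseq ha hd u
    nlinarith [mul_le_mul h1 h2 (by linarith) (by linarith)]
  rcases hu.lt_or_eq with hu' | rfl
  · exact key hu' hv
  · rw [mul_comm (aseq a d u), mul_comm (aseq a d u)]
    exact key (lt_of_le_of_ne hv (by simpa using h)) le_rfl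

lemma aseq_cross_lt (hd : 0 < d) {u u' v : ℕ} (ha : 1 < a) (hu : u < u') (hv : u' ≤ v) :
    aseq a d u * aseq a d (v + 1) < aseq a d u' * aseq a d v := by
  have h1 : aseq a d u + d ≤ aseq a d u' := by
    rw [← aseq_succ]; exact (aseq_strictMono hd).monotone hu
  have h2 : aseq a d u < aseq a d v := aseq_strictMono hd (hu.trans_le hv)
  have h3 := one_lt_aseq ha hd v
  rw [aseq_succ]
  nlinarith

lemma aseq_eq_zero_of_mul_eq (ha : 1 < a) (hd : 0 < d) {u v : ℕ}
    (h : aseq a d u * aseq a d v = aseq a d (v + 1)) : u = 0 := by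
  by_contra hu
  obtain ⟨w, rfl⟩ := Nat.exists_eq_succ_of_ne_zero hu
  have h1 := one_lt_aseq ha hd w
  have h2 := one_lt_aseq ha hd v
  rw [Nat.succ_eq_add_one, aseq_succ, aseq_succ] at h
  nlinarith

end aseq

section Adaptive

variable {a d : ℝ} {S : Set ℕ} {U V : ℕ → ℕ} {q : ℕ}

/-- The pairs `(U n, V n)` with `n ∈ S` are distinct and form a chain in the product order. -/
def IsPairChain (S : Set ℕ) (U V : ℕ → ℕ) : Prop :=
  ∀ n ∈ S, ∀ n' ∈ S, n ≠ n' →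
    (U n ≤ U n' ∧ V n ≤ V n' ∧ (U n ≠ U n' ∨ V n ≠ V n')) ∨
      (U n' ≤ U n ∧ V n' ≤ V n ∧ (U n' ≠ U n ∨ V n' ≠ V n))

/-- The product of the two labels of index `U n` and `q + π (V n)`. -/
noncomputable def pairProd (a d : ℝ) (q : ℕ) (U V : ℕ → ℕ) (π : Equiv.Perm ℕ) (n : ℕ) : ℝ :=
  aseq a d (U n) * aseq a d (q + π (V n))

lemma lt_of_aseq_eq_pairProd (ha : 1 < a) (hd : 0 < d) {π : Equiv.Perm ℕ} {c n : ℕ}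
    (h : aseq a d (q + c) = pairProd a d q U V π n) : π (V n) < c := by
  by_contra! hc
  have h1 : aseq a d (q + c) ≤ aseq a d (q + π (V n)) :=
    (aseq_strictMono hd).monotone (by omega)
  have h2 := one_lt_aseq ha hd (U n)
  have h3 := one_lt_aseq ha hd (q + π (V n))
  simp only [pairProd] at h
  nlinarith

lemma pairProd_injOn (ha : 1 < a) (hd : 0 < d) (hS : IsPairChain S U V)
    (hU : ∀ n ∈ S, U n < q) {π : Equiv.Perm ℕ} (hπ : ∀ y y', y < y' → π y ≤ π y' + 1) :
    Set.InjOn (pairProd a d q U V π) S := by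
  have key : ∀ n ∈ S, ∀ n' ∈ S, (U n ≤ U n' ∧ V n ≤ V n' ∧ (U n ≠ U n' ∨ V n ≠ V n')) →
      pairProd a d q U V π n ≠ pairProd a d q U V π n' := by
    rintro n hn n' hn' ⟨h1, h2, h3⟩
    simp only [pairProd]
    by_cases hv : V n = V n'
    · rw [hv]
      have := aseq_mul_lt ha hd h1 (le_refl (q + π (V n'))) (by tauto)
      linarith
    · have hlt : V n < V n' := by omega
      have hne : π (V n) ≠ π (V n') := fun h => hv (π.injective h)
      rcases lt_or_gt_of_ne hne with hl | hg
      · have := aseq_mul_lt ha hd h1 (show q + π (V n) ≤ q + π (V n') by omega) (by omega)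
        linarith
      · have heq : π (V n) = π (V n') + 1 := by have := hπ _ _ hlt; omega
        rcases h1.lt_or_eq with h1 | h1
        · have := aseq_cross_lt (v := q + π (V n')) hd ha h1 (by have := hU n' hn'; omega)
          rw [heq, ← add_assoc]
          exact this.ne
        · rw [h1]
          have := aseq_mul_lt ha hd (le_refl (U n')) (show q + π (V n') ≤ q + π (V n) by omega)
            (by omega)
          linarith
  intro n hn n' hn' h
  by_contra hne
  rcases hS n hn n' hn' hne with hc | hc
  · exact key n hn n' hn' hc h
  · exact key n' hn' n hn hc h.symm

lemma swap_apply_cases (x y v : ℕ) :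
    v = x ∧ Equiv.swap x y v = y ∨ v = y ∧ Equiv.swap x y v = x ∨
      v ≠ x ∧ v ≠ y ∧ Equiv.swap x y v = v := by
  by_cases h1 : v = x
  · simp [h1]
  · by_cases h2 : v = y
    · simp [h2]
    · simp [h1, h2, Equiv.swap_apply_of_ne_of_ne]

/-- Two products realizing a difference of exactly `d` must be inverted by the transposition. -/
lemma swap_of_pairProd_add_eq (ha : 1 < a) (hd : 0 < d) (hS : IsPairChain S U V)
    (hU : ∀ n ∈ S, U n < q) {α n n' : ℕ} (hn : n ∈ S) (hn' : n' ∈ S)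
    (h : pairProd a d q U V (Equiv.swap α (α + 1)) n' + d =
      pairProd a d q U V (Equiv.swap α (α + 1)) n) :
    V n' = α ∧ V n = α + 1 ∧ U n' < U n := by
  have hne : n ≠ n' := by rintro rfl; linarith
  simp only [pairProd] at h
  rcases hS n hn n' hn' hne with ⟨h1, h2, h3⟩ | ⟨h1, h2, h3⟩
  · exfalso
    rcases swap_apply_cases α (α + 1) (V n) with ⟨e1, e2⟩ | ⟨e1, e2⟩ | ⟨e0, e1, e2⟩ <;>
    rcases swap_apply_cases α (α + 1) (V n') with ⟨f1, f2⟩ | ⟨f1, f2⟩ | ⟨f0, f1, f2⟩ <;>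
    rw [e2, f2] at h
    case inl.inl.inr.inl =>
      rcases h1.lt_or_eq with h1 | h1
      · have := aseq_cross_lt (v := q + α) hd ha h1 (by have := hU n' hn'; omega)
        rw [← add_assoc] at h
        linarith
      · have := aseq_mul_lt ha hd h1.ge (show q + α ≤ q + (α + 1) by omega) (by omega)
        linarith
    all_goals
      first
      | omega
      | (have := aseq_mul_lt ha hd h1 (show q + (Equiv.swap α (α + 1) (V n)) ≤
           q + (Equiv.swap α (α + 1) (V n')) by omega) (by omega)
         rw [e2, f2] at this
         linarith)
  · rcases swap_apply_cases α (α + 1) (V n) with ⟨e1, e2⟩ | ⟨e1, e2⟩ | ⟨e0, e1, e2⟩ <;>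
    rcases swap_apply_cases α (α + 1) (V n') with ⟨f1, f2⟩ | ⟨f1, f2⟩ | ⟨f0, f1, f2⟩ <;>
    rw [e2, f2] at h
    case inr.inr.inl.inl =>
      refine ⟨f1, e1, lt_of_le_of_ne h1 fun hu => ?_⟩
      have := aseq_mul_lt ha hd hu.ge (show q + α ≤ q + (α + 1) by omega) (by omega)
      linarith
    all_goals exfalso
    all_goals
      first
      | omega
      | (have := aseq_mul_lt ha hd h1 (show q + (Equiv.swap α (α + 1) (V n')) ≤
           q + (Equiv.swap α (α + 1) (V n)) by omega) (by omega)
         rw [e2, f2] at this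
         linarith)


/-- No product of a pair equals the label of the pair member with second coordinate `c`. -/
def Avoids (a d : ℝ) (q : ℕ) (S : Set ℕ) (U V : ℕ → ℕ) (π : Equiv.Perm ℕ) (c : ℕ) : Prop :=
  ∀ n ∈ S, aseq a d (q + π c) ≠ pairProd a d q U V π n

lemma Avoids.trans_swap (ha : 1 < a) (hd : 0 < d) {π : Equiv.Perm ℕ} {c c' : ℕ}
    (h : Avoids a d q S U V π c) (hc : π c < c') :
    Avoids a d q S U V (π.trans (Equiv.swap c' (c' + 1))) c := by
  intro n hn he
  have hlt := lt_of_aseq_eq_pairProd ha hd he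
  apply h n hn
  simp only [pairProd, Equiv.trans_apply] at he hlt ⊢
  rcases swap_apply_cases c' (c' + 1) (π (V n)) with ⟨e1, e2⟩ | ⟨e1, e2⟩ | ⟨e0, e1, e2⟩ <;>
  rcases swap_apply_cases c' (c' + 1) (π c) with ⟨f1, f2⟩ | ⟨f1, f2⟩ | ⟨f0, f1, f2⟩ <;>
  first
  | omega
  | (rw [e2, f2] at he; exact he)

lemma exists_pairProd_add_eq (ha : 1 < a) (hd : 0 < d) {π : Equiv.Perm ℕ} {c : ℕ}
    (hπ : ∀ v, c ≤ v → π v = v) (h1 : ¬ Avoids a d q S U V π (c + 1))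
    (h2 : ¬ Avoids a d q S U V (π.trans (Equiv.swap c (c + 1))) (c + 1)) :
    ∃ n ∈ S, ∃ n' ∈ S, pairProd a d q U V π n = aseq a d (q + (c + 1)) ∧
      pairProd a d q U V π n' + d = pairProd a d q U V π n := by
  simp only [Avoids, not_forall, not_not] at h1 h2
  obtain ⟨n, hn, h1⟩ := h1
  obtain ⟨n', hn', h2⟩ := h2
  have hlt := lt_of_aseq_eq_pairProd ha hd h2
  rw [hπ _ (by omega)] at h1
  simp only [pairProd, Equiv.trans_apply, hπ (c + 1) (by omega), Equiv.swap_apply_right] at h2 hlt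
  refine ⟨n, hn, n', hn', h1.symm, ?_⟩
  rw [← h1, ← add_assoc, aseq_succ, h2]
  rcases swap_apply_cases c (c + 1) (π (V n')) with ⟨e1, e2⟩ | ⟨e1, e2⟩ | ⟨e0, e1, e2⟩
  · omega
  · omega
  · rw [e2, pairProd]

lemma pairProd_add_ne (ha : 1 < a) (hd : 0 < d) (hS : IsPairChain S U V) {n n' : ℕ}
    (hn : n ∈ S) (hn' : n' ∈ S) : pairProd a d q U V 1 n' + d ≠ pairProd a d q U V 1 n := by
  intro h
  have hne : n ≠ n' := by rintro rfl; linarith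
  simp only [pairProd, Equiv.Perm.one_apply] at h
  rcases hS n hn n' hn' hne with ⟨h1, h2, h3⟩ | ⟨h1, h2, h3⟩
  · have := aseq_mul_lt ha hd h1 (show q + V n ≤ q + V n' by omega) (by omega)
    linarith
  · have := aseq_mul_lt ha hd h1 (show q + V n' ≤ q + V n by omega) (by omega)
    linarith

lemma exists_perm_avoids (ha : 1 < a) (hd : 0 < d) (hS : IsPairChain S U V)
    (hU : ∀ n ∈ S, U n < q) (c : ℕ) :
    ∃ π : Equiv.Perm ℕ, Set.InjOn (pairProd a d q U V π) S ∧ Avoids a d q S U V π c ∧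
      (∀ v, v ≤ π v ∨ v = π v + 1 ∧ v = c) ∧ ∀ v, c < v → π v = v := by
  have h1inj : Set.InjOn (pairProd a d q U V 1) S :=
    pairProd_injOn ha hd hS hU fun y y' h => by simp; omega
  by_cases h1 : Avoids a d q S U V 1 c
  · exact ⟨1, h1inj, h1, by simp, by simp⟩
  rcases c with _ | c
  · simp only [Avoids, not_forall, not_not] at h1
    obtain ⟨n, hn, h1⟩ := h1
    exact absurd (lt_of_aseq_eq_pairProd ha hd h1) (by simp)
  refine ⟨(1 : Equiv.Perm ℕ).trans (Equiv.swap c (c + 1)), ?_, ?_, ?_, ?_⟩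
  · refine pairProd_injOn ha hd hS hU fun y y' h => ?_
    simp only [Equiv.trans_apply, Equiv.Perm.one_apply]
    have := swap_apply_cases c (c + 1) y
    have := swap_apply_cases c (c + 1) y'
    omega
  · by_contra h2
    obtain ⟨n, hn, n', hn', -, h⟩ := exists_pairProd_add_eq ha hd (fun v _ => rfl) h1 h2
    exact pairProd_add_ne ha hd hS hn hn' h
  · intro v
    simp only [Equiv.trans_apply, Equiv.Perm.one_apply]
    have := swap_apply_cases c (c + 1) v
    omega
  · intro v hv
    simp only [Equiv.trans_apply, Equiv.Perm.one_apply]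
    have := swap_apply_cases c (c + 1) v
    omega

/-- With `π₁` fixing everything from `c` on and avoiding at `c₁`, either `π₁` or `π₁` followed by
the transposition of `c` and `c + 1` solves the problem for both ranks, or a difference
`d` occurs. -/
lemma exists_perm_avoids_or (ha : 1 < a) (hd : 0 < d) (hS : IsPairChain S U V)
    (hU : ∀ n ∈ S, U n < q) {c₁ c : ℕ} {π : Equiv.Perm ℕ} (hc : c₁ < c)
    (hmono : ∀ y y', y < y' → π y ≤ π y' + 1)
    (hfix : ∀ v, c ≤ v → π v = v) (hlow : ∀ v, v ≤ π v ∨ v = π v + 1 ∧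
      (v = c₁ ∨ v = c₁ + 1 ∧ 1 ≤ c₁)) (h1 : Avoids a d q S U V π c₁) :
    (∃ π : Equiv.Perm ℕ, Set.InjOn (pairProd a d q U V π) S ∧ Avoids a d q S U V π c₁ ∧
      Avoids a d q S U V π (c + 1) ∧
      (∀ v, v ≤ π v ∨ v = π v + 1 ∧ (v = c₁ ∨ v = c + 1 ∨ v = c₁ + 1 ∧ 1 ≤ c₁)) ∧
      ∀ v, c + 1 < v → π v = v) ∨
    ∃ n ∈ S, ∃ n' ∈ S, pairProd a d q U V π n = aseq a d (q + (c + 1)) ∧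
      pairProd a d q U V π n' + d = pairProd a d q U V π n := by
  have hlt : ∀ v, v < c → π v < c := by
    intro v hv
    by_contra! h
    have := π.injective (hfix (π v) h)
    omega
  by_cases h2 : Avoids a d q S U V π (c + 1)
  · left
    refine ⟨π, pairProd_injOn ha hd hS hU hmono, h1, h2, fun v => ?_, fun v hv => hfix v (by omega)⟩
    have := hlow v
    omega
  by_cases h3 : Avoids a d q S U V (π.trans (Equiv.swap c (c + 1))) (c + 1)
  · left
    refine ⟨_, pairProd_injOn ha hd hS hU fun y y' h => ?_, h1.trans_swap ha hd (hlt _ hc), h3,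
      fun v => ?_, fun v hv => ?_⟩
    · simp only [Equiv.trans_apply]
      have := swap_apply_cases c (c + 1) (π y)
      have := swap_apply_cases c (c + 1) (π y')
      have := hmono y y' h
      have := hlt y
      have := hlt y'
      have := hfix y
      have := hfix y'
      omega
    · simp only [Equiv.trans_apply]
      have := swap_apply_cases c (c + 1) (π v)
      have := hlt v
      have := hfix v
      have := hlow v
      omega
    · simp only [Equiv.trans_apply, hfix v (by omega)]
      have := swap_apply_cases c (c + 1) v
      omega
  · exact Or.inr (exists_pairProd_add_eq ha hd hfix h2 h3)

lemma exists_perm_avoids_two (ha : 1 < a) (hd : 0 < d) (hS : IsPairChain S U V)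
    (hU : ∀ n ∈ S, U n < q) {c₁ c₂ : ℕ} (hc : c₁ + 2 ≤ c₂) :
    ∃ π : Equiv.Perm ℕ, Set.InjOn (pairProd a d q U V π) S ∧ Avoids a d q S U V π c₁ ∧
      Avoids a d q S U V π c₂ ∧
      (∀ v, v ≤ π v ∨ v = π v + 1 ∧ (v = c₁ ∨ v = c₂ ∨ v = c₁ + 1 ∧ 1 ≤ c₁)) ∧
      ∀ v, c₂ < v → π v = v := by
  obtain ⟨c, rfl⟩ : ∃ c, c₂ = c + 1 := ⟨c₂ - 1, by omega⟩
  have hL := fun n => one_lt_aseq ha hd n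
  by_cases h1 : Avoids a d q S U V 1 c₁
  · rcases exists_perm_avoids_or ha hd hS hU (show c₁ < c by omega) (fun y y' h => by simp; omega)
      (fun v _ => rfl) (fun v => by simp) h1 with h | ⟨n, hn, n', hn', -, h⟩
    · exact h
    · exact absurd h (pairProd_add_ne ha hd hS hn hn')
  have h1' := h1
  simp only [Avoids, not_forall, not_not] at h1'
  obtain ⟨n₀, hn₀, h0⟩ := h1'
  have hlt₀ := lt_of_aseq_eq_pairProd ha hd h0
  simp only [Equiv.Perm.one_apply] at h0 hlt₀
  obtain ⟨e, rfl⟩ : ∃ e, c₁ = e + 1 := ⟨c₁ - 1, by omega⟩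
  have h2 : Avoids a d q S U V (Equiv.swap e (e + 1)) (e + 1) := by
    by_contra h2
    obtain ⟨n, hn, n', hn', -, h⟩ := exists_pairProd_add_eq ha hd (fun v _ => rfl) h1 h2
    exact pairProd_add_ne ha hd hS hn hn' h
  rcases exists_perm_avoids_or ha hd hS hU (show e + 1 < c by omega) (fun y y' h => by
      have := swap_apply_cases e (e + 1) y
      have := swap_apply_cases e (e + 1) y'
      omega) (fun v hv => by have := swap_apply_cases e (e + 1) v; omega)
      (fun v => by have := swap_apply_cases e (e + 1) v; omega) h2 with h | ⟨n, hn, n', hn', hn2, h⟩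
  · exact h
  obtain ⟨hv', hv, hu⟩ := swap_of_pairProd_add_eq ha hd hS hU hn hn' h
  rw [hn2] at h
  simp only [pairProd, hv, Equiv.swap_apply_right] at hn2
  simp only [pairProd, hv', Equiv.swap_apply_left] at h
  simp only [pairProd, Equiv.Perm.one_apply] at h0
  -- the second rank cannot directly follow the three ranks involved
  have hce : c ≠ e + 2 := by
    rintro rfl
    have h3 : aseq a d (U n') * aseq a d (q + (e + 1)) = aseq a d (q + (e + 1) + 1) := by
      have : aseq a d (q + (e + 2 + 1)) = aseq a d (q + (e + 1) + 1) + d := by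
        rw [← aseq_succ]; congr 1
      linarith
    have hu' := aseq_eq_zero_of_mul_eq ha hd h3
    rw [hu', aseq_zero] at h3
    have hu0 : U n₀ = 0 := by
      by_cases hve : V n₀ = e
      · refine aseq_eq_zero_of_mul_eq ha hd (v := q + e) ?_
        rw [hve] at h0
        rw [← h0]; rfl
      · rcases hS n₀ hn₀ n' hn' (by rintro rfl; omega) with h | h <;> omega
    rw [hu0, aseq_zero] at h0
    simp only [aseq] at h3 h0
    push_cast at h3 h0
    have hle : (V n₀ : ℝ) ≤ e := by exact_mod_cast (by omega : V n₀ ≤ e)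
    have hd' : a * d * (e + 1 - V n₀) = d := by linarith
    have : a * d * 1 ≤ a * d * (e + 1 - V n₀) :=
      mul_le_mul_of_nonneg_left (by linarith) (by positivity)
    nlinarith
  have h3 : Avoids a d q S U V (Equiv.swap (e + 1) (e + 2)) (e + 1) := by
    intro p hp hpe
    have hlt := lt_of_aseq_eq_pairProd ha hd hpe
    simp only [Equiv.swap_apply_left] at hpe hlt
    rcases swap_apply_cases (e + 1) (e + 2) (V p) with ⟨e1, e2⟩ | ⟨e1, e2⟩ | ⟨e0, e1, e2⟩
    · omega
    · have hup : U p = 0 := by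
        apply aseq_eq_zero_of_mul_eq ha hd (v := q + (e + 1))
        rw [pairProd, e2] at hpe
        rw [← hpe]; congr 1
      rcases hS p hp n hn (by rintro rfl; omega) with h | h <;> omega
    · apply pairProd_add_ne ha hd hS (q := q) hp hn₀
      rw [pairProd, pairProd, Equiv.Perm.one_apply, Equiv.Perm.one_apply, ← h0, ← aseq_succ,
        ← e2, ← pairProd, ← hpe]; rfl
  rcases exists_perm_avoids_or ha hd hS hU (show e + 1 < c by omega) (fun y y' h => by
      have := swap_apply_cases (e + 1) (e + 2) y
      have := swap_apply_cases (e + 1) (e + 2) y'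
      omega) (fun v hv => by have := swap_apply_cases (e + 1) (e + 2) v; omega)
      (fun v => by have := swap_apply_cases (e + 1) (e + 2) v; omega) h3 with
      h | ⟨m, hm, m', hm', hm2, hh⟩
  · exact h
  exfalso
  obtain ⟨hw', hw, hw2⟩ := swap_of_pairProd_add_eq ha hd hS hU hm hm' hh
  simp only [pairProd, hw, Equiv.swap_apply_right] at hm2
  have hle : U n ≤ U m := by
    rcases hS m hm n hn (by rintro rfl; omega) with h | h <;> omega
  have := aseq_mul_lt ha hd hle (show q + e ≤ q + (e + 1) by omega) (by omega)
  linarith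

end Adaptive

section Rank

variable {R Z : ℕ → Prop} {K n n' : ℕ}

/-- The number of `i < n` satisfying `p`. -/
noncomputable def numBelow (p : ℕ → Prop) (n : ℕ) : ℕ := Nat.count p n

lemma numBelow_zero (p : ℕ → Prop) : numBelow p 0 = 0 := by simp [numBelow]

lemma numBelow_succ (p : ℕ → Prop) (n : ℕ) :
    numBelow p (n + 1) = numBelow p n + if p n then 1 else 0 := by
  simp [numBelow, Nat.count_succ]

lemma numBelow_mono (p : ℕ → Prop) : Monotone (numBelow p) := fun _ _ h => Nat.count_monotone p h

/-- Enumerate the `n < K` satisfying `Z`: first those satisfying `R` in increasing order, then the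
others in decreasing order.  This is the index of `n` in the enumeration. -/
noncomputable def twoSidedRank (R Z : ℕ → Prop) (K n : ℕ) : ℕ :=
  if R n then numBelow (fun i => R i ∧ Z i) n
  else numBelow Z K - 1 - numBelow (fun i => ¬ R i ∧ Z i) n

lemma numBelow_and_add_not_and (R Z : ℕ → Prop) (n : ℕ) :
    numBelow (fun i => R i ∧ Z i) n + numBelow (fun i => ¬ R i ∧ Z i) n = numBelow Z n := by
  induction n with
  | zero => simp [numBelow_zero]
  | succ n ih =>
    simp only [numBelow_succ]
    by_cases h1 : R n <;> by_cases h2 : Z n <;> simp [h1, h2] <;> omega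

lemma numBelow_add_not (Z : ℕ → Prop) (n : ℕ) :
    numBelow Z n + numBelow (fun i => ¬ Z i) n = n := by
  induction n with
  | zero => simp [numBelow_zero]
  | succ n ih =>
    simp only [numBelow_succ]
    by_cases h : Z n <;> simp [h] <;> omega

lemma numBelow_lt {p : ℕ → Prop} (hn : n < n') (h : p n) :
    numBelow p n < numBelow p n' := by
  have h1 : numBelow p (n + 1) = numBelow p n + 1 := by simp [numBelow_succ, h]
  have h2 := numBelow_mono p (show n + 1 ≤ n' by omega)
  omega

lemma twoSidedRank_lt (hn : n < K) (h : Z n) : twoSidedRank R Z K n < numBelow Z K := by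
  have h0 := numBelow_lt hn h
  have h1 := numBelow_and_add_not_and R Z n
  rw [twoSidedRank]
  split_ifs <;> omega

lemma twoSidedRank_injOn : Set.InjOn (twoSidedRank R Z K) {n | n < K ∧ Z n} := by
  have key : ∀ {n n' : ℕ}, n < n' → n' < K → Z n → Z n' →
      twoSidedRank R Z K n ≠ twoSidedRank R Z K n' := by
    intro n n' hn hn' hz hz'
    have h0 := numBelow_and_add_not_and R Z K
    by_cases hr : R n <;> by_cases hr' : R n' <;>
      simp only [twoSidedRank, hr, hr', if_true, if_false]
    · exact (numBelow_lt (p := fun i => R i ∧ Z i) hn ⟨hr, hz⟩).ne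
    · have h1 := numBelow_lt (p := fun i => R i ∧ Z i) (hn.trans hn') ⟨hr, hz⟩
      have h2 := numBelow_lt (p := fun i => ¬ R i ∧ Z i) hn' ⟨hr', hz'⟩
      omega
    · have h1 := numBelow_lt (p := fun i => ¬ R i ∧ Z i) (hn.trans hn') ⟨hr, hz⟩
      have h2 := numBelow_lt (p := fun i => R i ∧ Z i) hn' ⟨hr', hz'⟩
      omega
    · have h1 := numBelow_lt (p := fun i => ¬ R i ∧ Z i) hn ⟨hr, hz⟩
      have h2 := numBelow_lt (p := fun i => ¬ R i ∧ Z i) hn' ⟨hr', hz'⟩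
      omega
  rintro n ⟨hn, hz⟩ n' ⟨hn', hz'⟩ h
  rcases lt_trichotomy n n' with hlt | rfl | hlt
  · exact absurd h (key hlt hn' hz hz')
  · rfl
  · exact absurd h.symm (key hlt hn hz' hz)

lemma twoSidedRank_succ (hr : R n ↔ R (n + 1)) (hz : ¬ Z n) :
    twoSidedRank R Z K (n + 1) = twoSidedRank R Z K n := by
  by_cases h : R n
  · simp [twoSidedRank, numBelow_succ, h, hr.1 h, hz]
  · simp [twoSidedRank, numBelow_succ, h, mt hr.2 h, hz]

lemma twoSidedRank_compare (hn : n < n') (hn' : n' + 1 < K) (hr : R n ↔ R (n + 1))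
    (hr' : R n' ↔ R (n' + 1)) (hz : Z n ∨ Z (n + 1)) (hz' : Z n' ∨ Z (n' + 1)) :
    (R n ∧ twoSidedRank R Z K n ≤ twoSidedRank R Z K n' ∧
      (Z n ∨ ¬ R n' → twoSidedRank R Z K n < twoSidedRank R Z K n')) ∨
    (¬ R n ∧ twoSidedRank R Z K n' ≤ twoSidedRank R Z K n ∧
      (Z n ∨ R n' → twoSidedRank R Z K n' < twoSidedRank R Z K n)) := by
  have h0 := numBelow_and_add_not_and R Z K
  have key : ∀ (p : ℕ → Prop) (n : ℕ), n + 1 < K → p n ∨ p (n + 1) →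
      numBelow p n < numBelow p K := by
    rintro p n h (hp | hp)
    · exact numBelow_lt (by omega) hp
    · exact (numBelow_mono p n.le_succ).trans_lt (numBelow_lt h hp)
  by_cases h : R n <;> by_cases h' : R n' <;>
    simp only [twoSidedRank, h, h', if_true, if_false, true_and, false_and, not_true, not_false_iff,
      or_false, false_or, or_true]
  · refine ⟨numBelow_mono _ hn.le, fun hz => numBelow_lt hn ⟨h, hz⟩⟩
  · have h1 := key (fun i => R i ∧ Z i) n (by omega) (by tauto)
    have h2 := key (fun i => ¬ R i ∧ Z i) n' (by omega) (by tauto)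
    simp only [forall_true_left]
    omega
  · have h1 := key (fun i => ¬ R i ∧ Z i) n (by omega) (by tauto)
    have h2 := key (fun i => R i ∧ Z i) n' (by omega) (by tauto)
    simp only [forall_true_left]
    omega
  · have h2 := key (fun i => ¬ R i ∧ Z i) n' (by omega) (by tauto)
    have h3 := numBelow_mono (fun i => ¬ R i ∧ Z i) hn.le
    refine ⟨by omega, fun hz => ?_⟩
    have h4 := numBelow_lt (p := fun i => ¬ R i ∧ Z i) hn ⟨h, hz⟩
    omega

lemma twoSidedRank_isPairChain {R Y : ℕ → Prop} {K : ℕ} {S : Set ℕ}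
    (hS : ∀ n ∈ S, n + 1 < K ∧ (R n ↔ R (n + 1)) ∧ (Y n ↔ ¬ Y (n + 1))) :
    IsPairChain S (twoSidedRank R (fun i => ¬ Y i) K) (twoSidedRank R Y K) := by
  have key : ∀ n ∈ S, ∀ n' ∈ S, n < n' →
    (twoSidedRank R (fun i => ¬ Y i) K n ≤ twoSidedRank R (fun i => ¬ Y i) K n' ∧
      twoSidedRank R Y K n ≤ twoSidedRank R Y K n' ∧
      (twoSidedRank R (fun i => ¬ Y i) K n ≠ twoSidedRank R (fun i => ¬ Y i) K n' ∨
        twoSidedRank R Y K n ≠ twoSidedRank R Y K n')) ∨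
    (twoSidedRank R (fun i => ¬ Y i) K n' ≤ twoSidedRank R (fun i => ¬ Y i) K n ∧
      twoSidedRank R Y K n' ≤ twoSidedRank R Y K n ∧
      (twoSidedRank R (fun i => ¬ Y i) K n' ≠ twoSidedRank R (fun i => ¬ Y i) K n ∨
        twoSidedRank R Y K n' ≠ twoSidedRank R Y K n)) := by
    intro n hn n' hn' hlt
    obtain ⟨h1, h2, h3⟩ := hS n hn
    obtain ⟨h1', h2', h3'⟩ := hS n' hn'
    have c1 := twoSidedRank_compare (Z := Y) hlt h1' h2 h2' (by tauto) (by tauto)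
    have c2 := twoSidedRank_compare (Z := fun i => ¬ Y i) hlt h1' h2 h2' (by tauto) (by tauto)
    by_cases hr : R n <;> by_cases hy : Y n <;>
      simp only [hr, hy, true_and, true_or, not_true, not_false_iff, false_and, or_false,
        false_or, forall_true_left] at c1 c2 <;> omega
  intro n hn n' hn' hne
  rcases lt_or_gt_of_ne hne with h | h
  · exact key n hn n' hn' h
  · exact (key n' hn' n hn h).symm

end Rank

section Profile

/-- A walk of heights `g 0, …, g K` with steps `±1`, ending with an up-step, whose rightmost minimum
is at `s ≠ 1`. -/
structure IsProfile (g : ℕ → ℤ) (s K : ℕ) : Prop where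
  lt : s < K
  ne_one : s ≠ 1
  step : ∀ i < K, g (i + 1) = g i + 1 ∨ g (i + 1) = g i - 1
  last : g K = g (K - 1) + 1
  lt_of_lt : ∀ i ≤ K, s < i → g s < g i
  le_of_lt : ∀ i < s, g s ≤ g i

/-- The edge at position `n` leads upwards, when the edges are visited from `s` to the right and
then from `s` to the left, the left ones being read towards `0`. -/
def IsUpEdge (g : ℕ → ℤ) (s K n : ℕ) : Prop :=
  if n < K - s then g (s + n) < g (s + n + 1) else g (K - n) < g (K - 1 - n)

/-- The edge at position `n` receives a label from the upper half. -/
def IsHighEdge (s K n : ℕ) : Prop :=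
  if n < K - s then n % 2 = (if s = 0 then 1 else 0) else (n - (K - s)) % 2 = 0

attribute [local irreducible] numBelow twoSidedRank

variable {g : ℕ → ℤ} {s K : ℕ}

lemma IsProfile.numBelow_right (h : IsProfile g s K) {n : ℕ} (hn : n ≤ K - s) :
    2 * (numBelow (IsUpEdge g s K) n : ℤ) = n + (g (s + n) - g s) ∧
    (s = 0 → 2 * numBelow (IsHighEdge s K) n + n % 2 = n) ∧
    (s ≠ 0 → 2 * numBelow (IsHighEdge s K) n = n + n % 2) := by
  induction n with
  | zero => simp [numBelow_zero]
  | succ n ih =>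
    obtain ⟨h1, h2, h3⟩ := ih (by omega)
    have hg := h.step (s + n) (by omega)
    rw [numBelow_succ, numBelow_succ]
    simp only [IsUpEdge, IsHighEdge, show n < K - s by omega, if_true, ← add_assoc] at *
    refine ⟨?_, fun hs => ?_, fun hs => ?_⟩
    · split_ifs <;> push_cast <;> omega
    · have := h2 hs
      simp only [hs, if_true] at *
      split_ifs <;> omega
    · have := h3 hs
      simp only [hs, if_false] at *
      split_ifs <;> omega

lemma IsProfile.numBelow_left (h : IsProfile g s K) (j : ℕ) : ∀ i, i + j = s →
    2 * (numBelow (IsUpEdge g s K) (K - s + j) : ℤ) =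
      (K - s + j : ℕ) + (g K - g s) + (g i - g s) ∧
    (s ≠ 0 → 2 * numBelow (IsHighEdge s K) (K - s + j) = (K - s + j) + (K - s) % 2 + j % 2) := by
  have hlt := h.lt
  induction j with
  | zero =>
    rintro i rfl
    have := h.numBelow_right le_rfl
    rw [show i + 0 + (K - (i + 0)) = K by omega] at this
    simp only [add_zero] at *
    exact ⟨by omega, by simpa using this.2.2⟩
  | succ j ih =>
    intro i hi
    obtain ⟨h1, h2⟩ := ih (i + 1) (by omega)
    have hg := h.step i (by omega)
    rw [← add_assoc, numBelow_succ, numBelow_succ]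
    simp only [IsUpEdge, IsHighEdge, show ¬ K - s + j < K - s by omega, if_false,
      show K - (K - s + j) = i + 1 by omega, show K - 1 - (K - s + j) = i by omega,
      show K - s + j - (K - s) = j by omega] at *
    refine ⟨?_, fun hs => ?_⟩
    · split_ifs <;> push_cast <;> omega
    · have := h2 hs
      split_ifs <;> omega

lemma IsProfile.numBelow_high (h : IsProfile g s K) :
    (s = 0 → 2 * numBelow (IsHighEdge s K) K + K % 2 = K) ∧
    (s ≠ 0 → 2 * numBelow (IsHighEdge s K) K = K + (K - s) % 2 + s % 2) := by
  have hlt := h.lt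
  have h1 := (h.numBelow_right le_rfl).2.1
  have h2 := (h.numBelow_left s 0 (by omega)).2
  rw [show K - s + s = K by omega] at h2
  refine ⟨fun hs => ?_, h2⟩
  have := h1 hs
  rw [show K - s = K by omega] at this
  omega

/-- The rank of the edge at position `n` among the low edges, if it is one of them. -/
noncomputable abbrev lowRank (g : ℕ → ℤ) (s K n : ℕ) : ℕ :=
  twoSidedRank (IsUpEdge g s K) (fun i => ¬ IsHighEdge s K i) K n

/-- The rank of the edge at position `n` among the high edges, if it is one of them. -/
noncomputable abbrev highRank (g : ℕ → ℤ) (s K n : ℕ) : ℕ :=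
  twoSidedRank (IsUpEdge g s K) (IsHighEdge s K) K n

lemma numBelow_split (R Y : ℕ → Prop) (n : ℕ) :
    numBelow (fun i => R i ∧ Y i) n + numBelow (fun i => R i ∧ ¬ Y i) n = numBelow R n ∧
    numBelow (fun i => R i ∧ Y i) n + numBelow (fun i => ¬ R i ∧ Y i) n = numBelow Y n ∧
    numBelow (fun i => R i ∧ ¬ Y i) n + numBelow (fun i => ¬ R i ∧ ¬ Y i) n + numBelow Y n = n := by
  have h1 := numBelow_and_add_not_and Y R n
  have h2 := numBelow_and_add_not_and R Y n
  have h3 := numBelow_and_add_not_and R (fun i => ¬ Y i) n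
  have h4 := numBelow_add_not Y n
  simp only [and_comm (a := Y _), and_comm (a := ¬ Y _)] at h1
  omega

/-- The purely arithmetic part of the junction estimate. -/
lemma rank_add_rank_of_junction {R Y : ℕ → Prop} {K n : ℕ} {D E F : ℤ} (hn : n + 1 < K)
    (hD : 2 * (numBelow R n : ℤ) = n + D) (hE : 2 * (numBelow Y n : ℤ) = n + E)
    (hF : 2 * (numBelow Y K : ℤ) = K + F)
    (hR : R n ↔ ¬ R (n + 1)) (hY : Y n ↔ ¬ Y (n + 1)) :
    ∃ x y, (x = n ∧ y = n + 1 ∨ x = n + 1 ∧ y = n) ∧ ¬ Y x ∧ Y y ∧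
      (R y → 2 * ((twoSidedRank R (fun i => ¬ Y i) K x : ℤ) + twoSidedRank R Y K y + 1 -
        numBelow Y K) = D + E - 2 * F) ∧
      (¬ R y → 2 * ((twoSidedRank R (fun i => ¬ Y i) K x : ℤ) + twoSidedRank R Y K y + 1 -
        numBelow Y K) = D - E) := by
  have h1 := numBelow_split R Y n
  have h2 := numBelow_split R Y K
  have hx := numBelow_add_not Y K
  have s1 := numBelow_succ (fun i => R i ∧ Y i) n
  have s2 := numBelow_succ (fun i => R i ∧ ¬ Y i) n
  have s3 := numBelow_succ (fun i => ¬ R i ∧ Y i) n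
  have s4 := numBelow_succ (fun i => ¬ R i ∧ ¬ Y i) n
  have k1 : ∀ (p : ℕ → Prop) (m : ℕ), m < K → p m → numBelow p m < numBelow p K :=
    fun p m h hp => numBelow_lt h hp
  by_cases hr : R n <;> by_cases hy : Y n
  · have hr' : ¬ R (n + 1) := hR.1 hr
    have hy' : ¬ Y (n + 1) := hY.1 hy
    have a1 := k1 (fun i => R i ∧ Y i) n (by omega) ⟨hr, hy⟩
    have a2 := k1 (fun i => ¬ R i ∧ ¬ Y i) (n + 1) (by omega) ⟨hr', hy'⟩
    refine ⟨n + 1, n, by simp, hy', hy, fun _ => ?_, fun h => absurd hr h⟩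
    simp only [twoSidedRank, hr, hr', hy, hy', if_true, if_false, not_true, not_false_iff, and_true,
      and_false] at *
    omega
  · have hr' : ¬ R (n + 1) := hR.1 hr
    have hy' : Y (n + 1) := by tauto
    have a1 := k1 (fun i => R i ∧ ¬ Y i) n (by omega) ⟨hr, hy⟩
    have a2 := k1 (fun i => ¬ R i ∧ Y i) (n + 1) (by omega) ⟨hr', hy'⟩
    refine ⟨n, n + 1, by simp, hy, hy', fun h => absurd h hr', fun _ => ?_⟩
    simp only [twoSidedRank, hr, hr', hy, hy', if_true, if_false, not_true, not_false_iff, and_true,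
      and_false] at *
    omega
  · have hr' : R (n + 1) := by tauto
    have hy' : ¬ Y (n + 1) := hY.1 hy
    have a1 := k1 (fun i => ¬ R i ∧ Y i) n (by omega) ⟨hr, hy⟩
    have a2 := k1 (fun i => R i ∧ ¬ Y i) (n + 1) (by omega) ⟨hr', hy'⟩
    refine ⟨n + 1, n, by simp, hy', hy, fun h => absurd h hr, fun _ => ?_⟩
    simp only [twoSidedRank, hr, hr', hy, hy', if_true, if_false, not_true, not_false_iff, and_true,
      and_false] at *
    omega
  · have hr' : R (n + 1) := by tauto
    have hy' : Y (n + 1) := by tauto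
    have a1 := k1 (fun i => ¬ R i ∧ ¬ Y i) n (by omega) ⟨hr, hy⟩
    have a2 := k1 (fun i => R i ∧ Y i) (n + 1) (by omega) ⟨hr', hy'⟩
    refine ⟨n, n + 1, by simp, hy, hy', fun _ => ?_, fun h => absurd hr' h⟩
    simp only [twoSidedRank, hr, hr', hy, hy', if_true, if_false, not_true, not_false_iff, and_true,
      and_false] at *
    omega


lemma isHighEdge_succ {n : ℕ} (hns : n + 1 ≠ K - s) :
    IsHighEdge s K n ↔ ¬ IsHighEdge s K (n + 1) := by
  simp only [IsHighEdge]
  split_ifs <;> omega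

lemma isUpEdge_right {n : ℕ} (hn : n < K - s) :
    IsUpEdge g s K n ↔ g (s + n) < g (s + n + 1) := by
  simp only [IsUpEdge, hn, if_true]

lemma isHighEdge_right {n : ℕ} (hn : n < K - s) :
    IsHighEdge s K n ↔ n % 2 = (if s = 0 then 1 else 0) := by
  simp only [IsHighEdge, hn, if_true]

lemma isUpEdge_left {i j : ℕ} (hs : s < K) (h : i + 1 + j = s) :
    IsUpEdge g s K (K - s + j) ↔ g (i + 1) < g i := by
  simp only [IsUpEdge, show ¬ K - s + j < K - s by omega, if_false,
    show K - (K - s + j) = i + 1 by omega, show K - 1 - (K - s + j) = i by omega]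

lemma isHighEdge_left (s K j : ℕ) : IsHighEdge s K (K - s + j) ↔ j % 2 = 0 := by
  simp only [IsHighEdge, show ¬ K - s + j < K - s by omega, if_false,
    show K - s + j - (K - s) = j by omega]

lemma IsProfile.junction_right (h : IsProfile g s K) {n : ℕ} (hn : n + 1 < K - s)
    (hR : IsUpEdge g s K n ↔ ¬ IsUpEdge g s K (n + 1)) :
    ∃ x y, (x = n ∧ y = n + 1 ∨ x = n + 1 ∧ y = n) ∧ ¬ IsHighEdge s K x ∧ IsHighEdge s K y ∧
      numBelow (IsHighEdge s K) K ≤ lowRank g s K x + highRank g s K y + 2 ∧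
      (y = n + 1 → numBelow (IsHighEdge s K) K ≤ lowRank g s K x + highRank g s K y + 1) := by
  have hlt := h.lt
  obtain ⟨i1, i2, i3⟩ := h.numBelow_right (show n ≤ K - s by omega)
  obtain ⟨f1, f2⟩ := h.numBelow_high
  obtain ⟨x, y, hxy, hx, hy, e1, e2⟩ := rank_add_rank_of_junction (K := K)
    (E := 2 * numBelow (IsHighEdge s K) n - n) (F := 2 * numBelow (IsHighEdge s K) K - K)
    (by omega) i1 (by ring) (by ring) hR (isHighEdge_succ (by omega))
  refine ⟨x, y, hxy, hx, hy, ?_⟩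
  have g1 := h.step (s + n) (by omega)
  have g2 := h.step (s + n + 1) (by omega)
  have m1 := h.lt_of_lt (s + n + 1) (by omega) (by omega)
  have m2 := h.lt_of_lt (s + n + 1 + 1) (by omega) (by omega)
  have m0 : g s < g (s + n) ∨ n = 0 ∧ g (s + n) = g s := by
    rcases Nat.eq_zero_or_pos n with rfl | h0
    · exact Or.inr ⟨rfl, rfl⟩
    · exact Or.inl (h.lt_of_lt (s + n) (by omega) (by omega))
  have u1 := isUpEdge_right (g := g) (show n < K - s by omega)
  have u2 := isUpEdge_right (g := g) hn
  have v1 := isHighEdge_right (show n < K - s by omega)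
  have v2 := isHighEdge_right hn
  rw [← add_assoc] at u2
  rw [u1, u2] at hR
  simp only [lowRank, highRank]
  generalize numBelow (IsHighEdge s K) n = N at *
  generalize numBelow (IsHighEdge s K) K = M at *
  generalize (numBelow (IsUpEdge g s K) n : ℤ) = P at *
  clear h hlt
  have hF : (M : ℤ) * 2 - K ≤ 2 ∧ (s = 0 → (M : ℤ) * 2 - K ≤ 0) := by omega
  have hE : s = 0 ∧ (n : ℤ) - n % 2 = 2 * N ∨ s ≠ 0 ∧ (n : ℤ) + n % 2 = 2 * N := by omega
  clear f1 f2 i2 i3 hn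
  by_cases hr : IsUpEdge g s K y
  · have e := e1 hr
    clear e1 e2
    rcases hxy with ⟨rfl, rfl⟩ | ⟨rfl, rfl⟩
    · rw [u2] at hr
      rw [v2] at hy
      clear u1 u2 v1 v2
      split_ifs at hy <;> omega
    · rw [u1] at hr
      rw [v1] at hy
      clear u1 u2 v1 v2
      split_ifs at hy <;> omega
  · have e := e2 hr
    clear e1 e2
    rcases hxy with ⟨rfl, rfl⟩ | ⟨rfl, rfl⟩
    · rw [u2] at hr
      rw [v2] at hy
      clear u1 u2 v1 v2
      split_ifs at hy <;> omega
    · rw [u1] at hr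
      rw [v1] at hy
      clear u1 u2 v1 v2
      split_ifs at hy <;> omega

lemma IsProfile.junction_left (h : IsProfile g s K) {n : ℕ} (hn : n + 1 < K) (hn' : K - s ≤ n)
    (hR : IsUpEdge g s K n ↔ ¬ IsUpEdge g s K (n + 1)) :
    ∃ x y, (x = n ∧ y = n + 1 ∨ x = n + 1 ∧ y = n) ∧ ¬ IsHighEdge s K x ∧ IsHighEdge s K y ∧
      numBelow (IsHighEdge s K) K ≤ lowRank g s K x + highRank g s K y + 2 ∧
      (y = n + 1 ∨ n = K - s ∧ 2 ≤ K - s →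
        numBelow (IsHighEdge s K) K ≤ lowRank g s K x + highRank g s K y + 1) := by
  have hlt := h.lt
  obtain ⟨j, rfl⟩ := Nat.exists_eq_add_of_le hn'
  obtain ⟨i, hi⟩ : ∃ i, i + 1 + 1 + j = s := ⟨s - j - 2, by omega⟩
  obtain ⟨i1, i3⟩ := h.numBelow_left j (i + 1 + 1) hi
  obtain ⟨f1, f2⟩ := h.numBelow_high
  rw [add_assoc] at i1
  obtain ⟨x, y, hxy, hx, hy, e1, e2⟩ := rank_add_rank_of_junction (K := K)
    (E := 2 * numBelow (IsHighEdge s K) (K - s + j) - (K - s + j : ℕ))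
    (F := 2 * numBelow (IsHighEdge s K) K - K)
    (by omega) i1 (by ring) (by ring) hR (isHighEdge_succ (by omega))
  refine ⟨x, y, hxy, hx, hy, ?_⟩
  have g1 := h.step (i + 1) (by omega)
  have g2 := h.step i (by omega)
  have m0 := h.lt_of_lt K le_rfl hlt
  have m0' : K - s = 1 ∨ g s < g (K - 1) := by
    by_cases h1 : K - s = 1
    · exact Or.inl h1
    · exact Or.inr (h.lt_of_lt (K - 1) (by omega) (by omega))
  have m0'' := h.last
  have m1 := h.le_of_lt (i + 1) (by omega)
  have m2 := h.le_of_lt i (by omega)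
  have m3 : j = 0 ∨ g s ≤ g (i + 1 + 1) := by
    rcases Nat.eq_zero_or_pos j with h0 | h0
    · exact Or.inl h0
    · exact Or.inr (h.le_of_lt (i + 1 + 1) (by omega))
  have m3' : j = 0 → g (i + 1 + 1) = g s := by rintro rfl; rw [← hi]
  simp only [lowRank, highRank]
  have u1 := isUpEdge_left (g := g) hlt (show i + 1 + 1 + j = s by omega)
  have u2 := isUpEdge_left (g := g) hlt (show i + 1 + (j + 1) = s by omega)
  have v1 := isHighEdge_left s K j
  have v2 := isHighEdge_left s K (j + 1)
  rw [← add_assoc] at u2 v2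
  rw [u1, u2] at hR
  have hg : g (i + 1) = g (i + 1 + 1) + 1 ∧ g i = g (i + 1) - 1 ∨
      g (i + 1) = g (i + 1 + 1) - 1 ∧ g i = g (i + 1) + 1 := by
    clear e1 e2 f1 f2 i1 i3 m0 m0' m0'' m1 m2 m3 m3' v1 v2
    omega
  have hD : (g s ≤ g (i + 1 + 1) ∧ (j = 0 → 2 ≤ K - s → 2 ≤ g K - g s)) ∧
      (j = 0 → g (i + 1 + 1) = g s) := by
    clear e1 e2 f1 f2 i1 i3 hR hg g1 g2 m1 m2 v1 v2
    refine ⟨⟨by omega, fun _ hr => ?_⟩, m3'⟩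
    omega
  clear hR g1 g2 m0' m0'' m3 m3'
  have hs0 : s ≠ 0 := by omega
  have hF : 2 * (numBelow (IsHighEdge s K) K : ℤ) - K = ((K - s) % 2 : ℕ) + (s % 2 : ℕ) := by
    clear e1 e2 i1 i3 f1 hg hD hxy
    have := f2 hs0
    omega
  have hE : 2 * (numBelow (IsHighEdge s K) (K - s + j) : ℤ) - (K - s + j : ℕ) =
      ((K - s) % 2 : ℕ) + (j % 2 : ℕ) := by
    clear e1 e2 i1 f1 f2 hF hg hD hxy
    have := i3 hs0
    omega
  rw [hF, hE] at e1
  rw [hE] at e2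
  clear hF hE f1 f2 i1 i3 h
  by_cases hr : IsUpEdge g s K y
  · have e := e1 hr
    clear e1 e2
    rcases hxy with ⟨rfl, rfl⟩ | ⟨rfl, rfl⟩
    · rw [u2] at hr
      rw [v2] at hy
      clear u1 u2 v1 v2
      omega
    · rw [u1] at hr
      rw [v1] at hy
      clear u1 u2 v1 v2
      omega
  · have e := e2 hr
    clear e1 e2
    rcases hxy with ⟨rfl, rfl⟩ | ⟨rfl, rfl⟩
    · rw [u2] at hr
      rw [v2] at hy
      clear u1 u2 v1 v2
      omega
    · rw [u1] at hr
      rw [v1] at hy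
      clear u1 u2 v1 v2
      omega

end Profile

section PathLabeling

/-- An assignment `i ↦ A i` of label indices to the edges `0, …, K - 1` of a path whose vertices
with `J` carry pendants, `t` of them in total, the labels of index in `[h, h + t)` being reserved
for the pendants.  The products at the vertices without pendants are distinct and avoid the labels
of the two end edges, and the label indices of the edges at a vertex with pendants have
a large sum. -/
def HasPathLabeling (a d : ℝ) (K t : ℕ) (J : ℕ → Prop) : Prop :=
  ∃ (h : ℕ) (A : ℕ → ℕ), 1 ≤ h ∧ h ≤ K ∧ Set.InjOn A (Set.Iio K) ∧
    (∀ i < K, A i < h ∨ h + t ≤ A i ∧ A i < K + t) ∧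
    (∀ i, i + 1 < K → ¬ J (i + 1) →
      A i < h ∧ h + t ≤ A (i + 1) ∨ A (i + 1) < h ∧ h + t ≤ A i) ∧
    Set.InjOn (fun i => aseq a d (A i) * aseq a d (A (i + 1))) {i | i + 1 < K ∧ ¬ J (i + 1)} ∧
    (∀ i, i + 1 < K → J (i + 1) → K + t ≤ A i + A (i + 1) + 2) ∧
    ∀ i, i + 1 < K → ¬ J (i + 1) →
      aseq a d (A 0) ≠ aseq a d (A i) * aseq a d (A (i + 1)) ∧
      aseq a d (A (K - 1)) ≠ aseq a d (A i) * aseq a d (A (i + 1))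

attribute [local irreducible] numBelow twoSidedRank

variable {g : ℕ → ℤ} {s K : ℕ} {a d : ℝ}

/-- The positions of a junction whose two edges point in the same direction. -/
def straightJunctions (g : ℕ → ℤ) (s K : ℕ) : Set ℕ :=
  {n | n + 1 < K ∧ n + 1 ≠ K - s ∧ (IsUpEdge g s K n ↔ IsUpEdge g s K (n + 1))}

lemma isPairChain_straightJunctions (g : ℕ → ℤ) (s K : ℕ) :
    IsPairChain (straightJunctions g s K) (lowRank g s K) (highRank g s K) :=
  twoSidedRank_isPairChain fun _ hn => ⟨hn.1, hn.2.2, isHighEdge_succ hn.2.1⟩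

lemma lowRank_lt_of_mem {n : ℕ} (hn : n ∈ straightJunctions g s K) :
    lowRank g s K n < numBelow (fun i => ¬ IsHighEdge s K i) K := by
  by_cases h : IsHighEdge s K n
  · have h' := (isHighEdge_succ hn.2.1).1 h
    rw [lowRank, ← twoSidedRank_succ hn.2.2 (by simpa using h)]
    exact twoSidedRank_lt hn.1 h'
  · exact twoSidedRank_lt (by have := hn.1; omega) h

lemma IsProfile.isUpEdge_first_left (h : IsProfile g s K) (hs : s ≠ 0) :
    IsUpEdge g s K (K - s) := by
  obtain ⟨i, rfl⟩ := Nat.exists_eq_succ_of_ne_zero hs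
  have h1 := isUpEdge_left (g := g) h.lt (i := i) (j := 0) rfl
  rw [add_zero] at h1
  have := h.step i (by have := h.lt; omega)
  have := h.le_of_lt i (by omega)
  exact h1.2 (by simp only [Nat.succ_eq_add_one] at *; omega)

lemma IsProfile.isUpEdge_last_right (h : IsProfile g s K) : IsUpEdge g s K (K - s - 1) := by
  have hlt := h.lt
  rw [isUpEdge_right (by omega), show s + (K - s - 1) = K - 1 by omega,
    show K - 1 + 1 = K by omega]
  have := h.last
  omega

lemma IsProfile.highRank_ends (h : IsProfile g s K) (hs : s ≠ 0) (h1 : IsHighEdge s K (K - s - 1))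
    (h2 : IsHighEdge s K (K - 1)) :
    highRank g s K (K - s) = highRank g s K (K - s - 1) + 1 ∧
      highRank g s K (K - s - 1) + 2 ≤ highRank g s K (K - 1) ∧
      highRank g s K (K - s - 1) < K - s := by
  have hlt := h.lt
  have hs1 := h.ne_one
  have u1 := h.isUpEdge_last_right
  have u2 := h.isUpEdge_first_left hs
  have v2 : IsHighEdge s K (K - s) := by simpa using isHighEdge_left s K 0
  have e1 := numBelow_succ (fun i => IsUpEdge g s K i ∧ IsHighEdge s K i) (K - s - 1)
  have e2 := numBelow_succ (fun i => IsUpEdge g s K i ∧ IsHighEdge s K i) (K - s)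
  rw [if_pos ⟨u1, h1⟩, show K - s - 1 + 1 = K - s by omega] at e1
  rw [if_pos ⟨u2, v2⟩] at e2
  have e3 := numBelow_mono (fun i => IsUpEdge g s K i ∧ IsHighEdge s K i)
    (show K - s + 1 ≤ K - 1 by omega)
  have e4 := numBelow_mono (fun i => IsUpEdge g s K i ∧ IsHighEdge s K i) (show K - 1 ≤ K by omega)
  have e5 := numBelow_and_add_not_and (IsUpEdge g s K) (IsHighEdge s K) K
  have e6 := numBelow_add_not (fun i => IsUpEdge g s K i ∧ IsHighEdge s K i) (K - s - 1)
  simp only [highRank, twoSidedRank, u1, u2, if_true]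
  refine ⟨by omega, ?_, by omega⟩
  split_ifs with h3
  · omega
  · have := numBelow_lt (p := fun i => ¬ IsUpEdge g s K i ∧ IsHighEdge s K i)
      (show K - 1 < K by omega) ⟨h3, h2⟩
    omega

lemma perm_lt_of_fixed {π : Equiv.Perm ℕ} {c N v : ℕ} (hc : c < N) (hπ : ∀ v, c < v → π v = v)
    (hv : v < N) : π v < N := by
  by_contra! h
  have := π.injective (hπ (π v) (by omega))
  omega

lemma highRank_injOn {n n' : ℕ} (hn : n < K) (hn' : n' < K) (h : IsHighEdge s K n)
    (h' : IsHighEdge s K n') (he : highRank g s K n = highRank g s K n') : n = n' :=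
  twoSidedRank_injOn ⟨hn, h⟩ ⟨hn', h'⟩ he

/-- Permuting the high labels by `π` separates the products at the straight junctions from each
other and from the high end labels, while lowering only few labels, and each by at most one. -/
def IsGoodPerm (a d : ℝ) (q : ℕ) (g : ℕ → ℤ) (s K : ℕ) (π : Equiv.Perm ℕ) : Prop :=
  Set.InjOn (pairProd a d q (lowRank g s K) (highRank g s K) π) (straightJunctions g s K) ∧
  (∀ n, n = K - s - 1 ∨ n = K - 1 → IsHighEdge s K n →
    Avoids a d q (straightJunctions g s K) (lowRank g s K) (highRank g s K) π (highRank g s K n)) ∧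
  (∀ n < K, IsHighEdge s K n → highRank g s K n ≤ π (highRank g s K n) ∨
    highRank g s K n = π (highRank g s K n) + 1 ∧
      (n = K - s - 1 ∨ n = K - 1 ∨ n = K - s ∧ 2 ≤ K - s)) ∧
  ∀ v < numBelow (IsHighEdge s K) K, π v < numBelow (IsHighEdge s K) K

lemma IsProfile.exists_perm (h : IsProfile g s K) (ha : 1 < a) (hd : 0 < d) {q : ℕ}
    (hq : numBelow (fun i => ¬ IsHighEdge s K i) K ≤ q) :
    ∃ π : Equiv.Perm ℕ, IsGoodPerm a d q g s K π := by
  have hlt := h.lt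
  have hchain := isPairChain_straightJunctions g s K
  have hU : ∀ n ∈ straightJunctions g s K, lowRank g s K n < q :=
    fun n hn => (lowRank_lt_of_mem hn).trans_le hq
  have single : ∀ n₀ < K, IsHighEdge s K n₀ → (n₀ = K - s - 1 ∨ n₀ = K - 1) →
      (∀ n, n = K - s - 1 ∨ n = K - 1 → IsHighEdge s K n → n = n₀) →
      ∃ π : Equiv.Perm ℕ, IsGoodPerm a d q g s K π := by
    intro n₀ hn₀ hh hn₀' huniq
    obtain ⟨π, p1, p2, p3, p4⟩ := exists_perm_avoids ha hd hchain hU (highRank g s K n₀)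
    refine ⟨π, p1, fun n hn hh' => ?_, fun n hn hh' => ?_,
      fun v hv => perm_lt_of_fixed (twoSidedRank_lt hn₀ hh) p4 hv⟩
    · rw [huniq n hn hh']; exact p2
    · rcases p3 (highRank g s K n) with p | ⟨p, p'⟩
      · exact Or.inl p
      · have := highRank_injOn hn hn₀ hh' hh p'
        subst this
        exact Or.inr ⟨p, by tauto⟩
  by_cases h1 : IsHighEdge s K (K - s - 1) <;> by_cases h2 : IsHighEdge s K (K - 1)
  · by_cases hs : s = 0
    · refine single (K - 1) (by omega) h2 (by simp) fun n hn _ => by rw [hs] at hn; omega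
    obtain ⟨r1, r2, r3⟩ := h.highRank_ends hs h1 h2
    obtain ⟨π, p1, p2, p3, p4, p5⟩ := exists_perm_avoids_two ha hd hchain hU r2
    refine ⟨π, p1, ?_, fun n hn hh' => ?_,
      fun v hv => perm_lt_of_fixed (twoSidedRank_lt (by omega) h2) p5 hv⟩
    · rintro n (rfl | rfl) _
      · exact p2
      · exact p3
    · rcases p4 (highRank g s K n) with p | ⟨p, p' | p' | ⟨p', p''⟩⟩
      · exact Or.inl p
      · exact Or.inr ⟨p, Or.inl (highRank_injOn hn (by omega) hh' h1 p')⟩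
      · exact Or.inr ⟨p, Or.inr (Or.inl (highRank_injOn hn (by omega) hh' h2 p'))⟩
      · rw [← r1] at p'
        have v2 : IsHighEdge s K (K - s) := by simpa using isHighEdge_left s K 0
        exact Or.inr ⟨p, Or.inr (Or.inr ⟨highRank_injOn hn (by omega) hh' v2 p', by omega⟩)⟩
  · refine single (K - s - 1) (by omega) h1 (by simp) ?_
    rintro n (rfl | rfl) hn
    · rfl
    · exact absurd hn h2
  · refine single (K - 1) (by omega) h2 (by simp) ?_
    rintro n (rfl | rfl) hn
    · exact absurd hn h1
    · rfl
  · refine ⟨1, pairProd_injOn ha hd hchain hU fun y y' h => by simp; omega, ?_, by simp, by simp⟩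
    rintro n (rfl | rfl) hn
    · exact absurd hn h1
    · exact absurd hn h2

end PathLabeling

section ProfileLabeling

attribute [local irreducible] numBelow twoSidedRank

variable {g : ℕ → ℤ} {s K t : ℕ} {a d : ℝ} {π : Equiv.Perm ℕ}

/-- The position of the path edge `i`. -/
def edgePos (s K i : ℕ) : ℕ := if s ≤ i then i - s else K - 1 - i

lemma edgePos_lt (_ : s < K) {i : ℕ} (hi : i < K) : edgePos s K i < K := by
  unfold edgePos
  split_ifs <;> omega

lemma edgePos_injOn : Set.InjOn (edgePos s K) (Set.Iio K) := by
  intro i hi j hj h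
  simp only [edgePos, Set.mem_Iio] at *
  split_ifs at h <;> omega

/-- The label index at position `n`, if `t` labels are kept between the lower and the upper half. -/
noncomputable def posLabel (g : ℕ → ℤ) (s K t : ℕ) (π : Equiv.Perm ℕ) (n : ℕ) : ℕ :=
  if IsHighEdge s K n then numBelow (fun i => ¬ IsHighEdge s K i) K + t + π (highRank g s K n)
  else lowRank g s K n

lemma posLabel_high {n : ℕ} (h : IsHighEdge s K n) : posLabel g s K t π n =
    numBelow (fun i => ¬ IsHighEdge s K i) K + t + π (highRank g s K n) := if_pos h

lemma posLabel_low {n : ℕ} (h : ¬ IsHighEdge s K n) : posLabel g s K t π n = lowRank g s K n :=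
  if_neg h

lemma lowRank_lt {n : ℕ} (hn : n < K) (h : ¬ IsHighEdge s K n) :
    lowRank g s K n < numBelow (fun i => ¬ IsHighEdge s K i) K :=
  twoSidedRank_lt hn h

lemma posLabel_injOn : Set.InjOn (posLabel g s K t π) (Set.Iio K) := by
  intro n hn n' hn' h
  by_cases h1 : IsHighEdge s K n <;> by_cases h2 : IsHighEdge s K n'
  · rw [posLabel_high h1, posLabel_high h2] at h
    exact highRank_injOn hn hn' h1 h2 (π.injective (Nat.add_left_cancel h))
  · rw [posLabel_high h1, posLabel_low h2] at h
    have := lowRank_lt (g := g) hn' h2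
    omega
  · rw [posLabel_low h1, posLabel_high h2] at h
    have := lowRank_lt (g := g) hn h1
    omega
  · rw [posLabel_low h1, posLabel_low h2] at h
    exact twoSidedRank_injOn ⟨hn, h1⟩ ⟨hn', h2⟩ h

lemma posLabel_mul_posLabel {n : ℕ} (hn : n ∈ straightJunctions g s K) :
    aseq a d (posLabel g s K t π n) * aseq a d (posLabel g s K t π (n + 1)) =
      pairProd a d (numBelow (fun i => ¬ IsHighEdge s K i) K + t) (lowRank g s K) (highRank g s K)
        π n := by
  have hz := isHighEdge_succ (s := s) (K := K) hn.2.1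
  by_cases h : IsHighEdge s K n
  · rw [posLabel_high h, posLabel_low (hz.1 h), pairProd, lowRank,
      twoSidedRank_succ hn.2.2 (by simpa using h), mul_comm]
  · rw [posLabel_low h, posLabel_high (by tauto), pairProd, highRank, twoSidedRank_succ hn.2.2 h]

lemma IsProfile.exists_junction (h : IsProfile g s K) {i : ℕ} (hi : i + 1 < K) (his : i + 1 ≠ s) :
    ∃ n, n + 1 < K ∧ n + 1 ≠ K - s ∧
      (edgePos s K i = n ∧ edgePos s K (i + 1) = n + 1 ∨
        edgePos s K i = n + 1 ∧ edgePos s K (i + 1) = n) ∧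
      ((IsUpEdge g s K n ↔ IsUpEdge g s K (n + 1)) ↔
        g (i + 1 + 1) - g (i + 1) = g (i + 1) - g i) := by
  have hlt := h.lt
  have h1 := h.step i (by omega)
  have h2 := h.step (i + 1) hi
  by_cases hsi : s ≤ i
  · obtain ⟨n, rfl⟩ := Nat.exists_eq_add_of_le hsi
    have u1 := isUpEdge_right (g := g) (s := s) (K := K) (n := n) (by omega)
    have u2 := isUpEdge_right (g := g) (s := s) (K := K) (n := n + 1) (by omega)
    refine ⟨n, by omega, by omega, Or.inl ?_, ?_⟩
    · simp only [edgePos]; constructor <;> split_ifs <;> omega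
    · rw [u1, u2, ← add_assoc]; omega
  · obtain ⟨j, rfl⟩ : ∃ j, s = i + 1 + (j + 1) := ⟨s - i - 2, by omega⟩
    have u1 := isUpEdge_left (g := g) (i := i) (j := j + 1) hlt (by omega)
    have u2 := isUpEdge_left (g := g) (i := i + 1) (j := j) hlt (by omega)
    refine ⟨K - (i + 1 + (j + 1)) + j, by omega, by omega, Or.inr ?_, ?_⟩
    · simp only [edgePos]; constructor <;> split_ifs <;> omega
    · rw [add_assoc _ j 1, u1, u2]; omega

lemma IsGoodPerm.numBelow_le (hp : IsGoodPerm a d q g s K π) (h : IsProfile g s K) {n : ℕ}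
    (hn : n + 1 < K) (hns : n + 1 ≠ K - s)
    (hR : IsUpEdge g s K n ↔ ¬ IsUpEdge g s K (n + 1)) :
    ∃ x y, (x = n ∧ y = n + 1 ∨ x = n + 1 ∧ y = n) ∧ ¬ IsHighEdge s K x ∧ IsHighEdge s K y ∧
      numBelow (IsHighEdge s K) K ≤ lowRank g s K x + π (highRank g s K y) + 2 := by
  have hlt := h.lt
  by_cases hc : n + 1 < K - s
  · obtain ⟨x, y, hxy, hx, hy, h1, h2⟩ := h.junction_right hc hR
    refine ⟨x, y, hxy, hx, hy, ?_⟩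
    rcases hp.2.2.1 y (by omega) hy with h3 | ⟨h3, h4⟩
    · clear hp hR hx hy h; omega
    · have : y = n + 1 := by clear hp hR hx hy h h1 h2 h3; omega
      have := h2 this
      clear hp hR hx hy h; omega
  · obtain ⟨x, y, hxy, hx, hy, h1, h2⟩ := h.junction_left hn (by omega) hR
    refine ⟨x, y, hxy, hx, hy, ?_⟩
    rcases hp.2.2.1 y (by omega) hy with h3 | ⟨h3, h4⟩
    · clear hp hR hx hy h; omega
    · have : y = n + 1 ∨ n = K - s ∧ 2 ≤ K - s := by clear hp hR hx hy h h1 h2 h3; omega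
      have := h2 this
      clear hp hR hx hy h; omega

lemma IsGoodPerm.aseq_ne_pairProd
    (hp : IsGoodPerm a d (numBelow (fun i => ¬ IsHighEdge s K i) K + t) g s K π)
    (ha : 1 < a) (hd : 0 < d) {n : ℕ} (hn : n = K - s - 1 ∨ n = K - 1 ∨ n = 0 ∧ s = 0) (hn' : n < K)
    {n' : ℕ} (h' : n' ∈ straightJunctions g s K) :
    aseq a d (posLabel g s K t π n) ≠ pairProd a d (numBelow (fun i => ¬ IsHighEdge s K i) K + t)
      (lowRank g s K) (highRank g s K) π n' := by
  by_cases hh : IsHighEdge s K n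
  · rw [posLabel_high hh]
    refine hp.2.1 n ?_ hh n' h'
    rcases hn with hn | hn | ⟨rfl, rfl⟩
    · exact Or.inl hn
    · exact Or.inr hn
    · rw [isHighEdge_right (by omega)] at hh
      simp at hh
  · rw [posLabel_low hh]
    have h1 := lowRank_lt (g := g) hn' hh
    have h2 : aseq a d (lowRank g s K n) < aseq a d (numBelow (fun i => ¬ IsHighEdge s K i) K + t +
      π (highRank g s K n')) := aseq_strictMono hd (by omega)
    have h3 := one_lt_aseq ha hd (lowRank g s K n')
    rw [pairProd]
    nlinarith [one_lt_aseq ha hd (lowRank g s K n)]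

lemma IsProfile.hasPathLabeling (h : IsProfile g s K) (hK : 3 ≤ K) (ha : 1 < a) (hd : 0 < d) (t : ℕ)
    {J : ℕ → Prop}
    (hJ : ∀ i, i + 1 < K → (J (i + 1) ↔ g (i + 1 + 1) - g (i + 1) ≠ g (i + 1) - g i)) :
    HasPathLabeling a d K t J := by
  have hlt := h.lt
  obtain ⟨π, hp⟩ := h.exists_perm ha hd
    (q := numBelow (fun i => ¬ IsHighEdge s K i) K + t) (Nat.le_add_right _ _)
  have hsum := numBelow_add_not (IsHighEdge s K) K
  have hhigh : 1 ≤ numBelow (fun i => ¬ IsHighEdge s K i) K ∧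
      numBelow (IsHighEdge s K) K ≤ numBelow (fun i => ¬ IsHighEdge s K i) K + 2 := by
    have := h.numBelow_high
    by_cases hs : s = 0
    · have := this.1 hs; omega
    · have := this.2 hs; omega
  have straight : ∀ i, i + 1 < K → ¬ J (i + 1) → ∃ n ∈ straightJunctions g s K,
      (edgePos s K i = n ∧ edgePos s K (i + 1) = n + 1 ∨
        edgePos s K i = n + 1 ∧ edgePos s K (i + 1) = n) := by
    intro i hi hJi
    have his : i + 1 ≠ s := by
      rintro rfl
      refine hJi ((hJ i hi).2 ?_)
      have h1 := h.step i (by omega)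
      have h2 := h.step (i + 1) hi
      have h3 := h.lt_of_lt (i + 1 + 1) (by omega) (by omega)
      have h4 := h.le_of_lt i (by omega)
      omega
    obtain ⟨n, h1, h2, h3, h4⟩ := h.exists_junction hi his
    exact ⟨n, ⟨h1, h2, h4.2 (by simpa using (hJ i hi).not.1 hJi)⟩, h3⟩
  have hprod : ∀ i n, n ∈ straightJunctions g s K →
      (edgePos s K i = n ∧ edgePos s K (i + 1) = n + 1 ∨
        edgePos s K i = n + 1 ∧ edgePos s K (i + 1) = n) →
      aseq a d (posLabel g s K t π (edgePos s K i)) *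
        aseq a d (posLabel g s K t π (edgePos s K (i + 1))) =
      pairProd a d (numBelow (fun i => ¬ IsHighEdge s K i) K + t) (lowRank g s K) (highRank g s K)
        π n := by
    rintro i n hn (⟨h1, h2⟩ | ⟨h1, h2⟩)
    · rw [h1, h2, posLabel_mul_posLabel hn]
    · rw [h1, h2, mul_comm, posLabel_mul_posLabel hn]
  refine ⟨numBelow (fun i => ¬ IsHighEdge s K i) K, fun i => posLabel g s K t π (edgePos s K i),
    hhigh.1, by omega, ?_, ?_, ?_, ?_, ?_, ?_⟩
  · exact posLabel_injOn.comp edgePos_injOn fun i hi => edgePos_lt hlt hi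
  · intro i hi
    have hpos := edgePos_lt hlt hi
    by_cases hh : IsHighEdge s K (edgePos s K i)
    · have := hp.2.2.2 _ (twoSidedRank_lt (R := IsUpEdge g s K) hpos hh)
      simp only [posLabel_high hh, highRank] at *
      right; clear hp hJ straight h; omega
    · simp only [posLabel_low hh]
      exact Or.inl (lowRank_lt hpos hh)
  · intro i hi hJi
    obtain ⟨n, hn, hpos⟩ := straight i hi hJi
    have hz := isHighEdge_succ (s := s) (K := K) hn.2.1
    have key : ∀ x y, x < K → ¬ IsHighEdge s K x → IsHighEdge s K y →
        posLabel g s K t π x < numBelow (fun i => ¬ IsHighEdge s K i) K ∧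
        numBelow (fun i => ¬ IsHighEdge s K i) K + t ≤ posLabel g s K t π y := by
      intro x y hx h1 h2
      rw [posLabel_high h2, posLabel_low h1]
      exact ⟨lowRank_lt hx h1, by omega⟩
    have hn1 := hn.1
    rcases hpos with ⟨h1, h2⟩ | ⟨h1, h2⟩ <;> simp only [h1, h2] <;>
      by_cases hh : IsHighEdge s K n
    · exact Or.inr (key _ _ (by omega) (hz.1 hh) hh)
    · exact Or.inl (key _ _ (by omega) hh (by tauto))
    · exact Or.inl (key _ _ (by omega) (hz.1 hh) hh)
    · exact Or.inr (key _ _ (by omega) hh (by tauto))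
  · rintro i ⟨hi, hJi⟩ j ⟨hj, hJj⟩ hij
    obtain ⟨n, hn, hpos⟩ := straight i hi hJi
    obtain ⟨n', hn', hpos'⟩ := straight j hj hJj
    simp only [hprod i n hn hpos, hprod j n' hn' hpos'] at hij
    obtain rfl := hp.1 hn hn' hij
    simp only [edgePos] at hpos hpos'
    clear hprod straight hp hJ h hn hn' hij
    split_ifs at hpos hpos' <;> omega
  · intro i hi hJi
    by_cases his : i + 1 = s
    · have e1 : edgePos s K i = K - s := by simp only [edgePos]; split_ifs <;> omega
      have e2 : edgePos s K (i + 1) = 0 := by simp [edgePos, his]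
      have hh1 : IsHighEdge s K (K - s) := by simpa using isHighEdge_left s K 0
      have hh2 : IsHighEdge s K 0 := by
        rw [isHighEdge_right (by omega), if_neg (by omega)]
      simp only [e1, e2, posLabel_high hh1, posLabel_high hh2]
      have : highRank g s K (K - s) ≠ highRank g s K 0 := fun he => by
        have := highRank_injOn (by omega) (by omega) hh1 hh2 he
        omega
      have := π.injective.ne this
      clear hp straight hprod hJ h; omega
    · obtain ⟨n, h1, h2, h3, h4⟩ := h.exists_junction hi his
      have hR := h4.not.2 ((hJ i hi).1 hJi)
      obtain ⟨x, y, hxy, hx, hy, hle⟩ := hp.numBelow_le h h1 h2 (by tauto)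
      have : posLabel g s K t π (edgePos s K i) + posLabel g s K t π (edgePos s K (i + 1)) =
          posLabel g s K t π x + posLabel g s K t π y := by
        rcases h3 with ⟨e1, e2⟩ | ⟨e1, e2⟩ <;> rcases hxy with ⟨rfl, rfl⟩ | ⟨rfl, rfl⟩ <;>
          rw [e1, e2] <;> omega
      simp only [this, posLabel_low hx, posLabel_high hy]
      clear hp straight hprod hJ h h4 hR hx hy this; omega
  · intro i hi hJi
    obtain ⟨n, hn, hpos⟩ := straight i hi hJi
    simp only [hprod i n hn hpos]
    constructor <;> refine hp.aseq_ne_pairProd ha hd ?_ (edgePos_lt hlt (by omega)) hn <;>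
      simp only [edgePos] <;> split_ifs <;> omega

end ProfileLabeling

section Existence

variable {K t : ℕ} {a d : ℝ}

lemma exists_walk (J : ℕ → Prop) (hK : 1 ≤ K) : ∃ g : ℕ → ℤ,
    (∀ i, g (i + 1) = g i + 1 ∨ g (i + 1) = g i - 1) ∧ g K = g (K - 1) + 1 ∧
    ∀ i, J (i + 1) ↔ g (i + 1 + 1) - g (i + 1) ≠ g (i + 1) - g i := by
  let σ : ℕ → ℤ := fun n => Nat.rec 1 (fun i x => if J (i + 1) then -x else x) n
  have h1 : ∀ i, σ (i + 1) = if J (i + 1) then -σ i else σ i := fun i => rfl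
  have h2 : ∀ i, σ i = 1 ∨ σ i = -1 := by
    intro i
    induction i with
    | zero => exact Or.inl rfl
    | succ i ih =>
      rw [h1]
      split_ifs <;> omega
  have h3 : ∀ i, σ (K - 1) * ∑ j ∈ Finset.range (i + 1), σ j =
      σ (K - 1) * ∑ j ∈ Finset.range i, σ j + σ (K - 1) * σ i := by
    intro i
    rw [Finset.sum_range_succ, mul_add]
  refine ⟨fun i => σ (K - 1) * ∑ j ∈ Finset.range i, σ j, fun i => ?_, ?_, fun i => ?_⟩
  · simp only [h3]
    rcases h2 i with h | h <;> rcases h2 (K - 1) with h' | h' <;> rw [h, h'] <;> omega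
  · obtain ⟨k, rfl⟩ := Nat.exists_eq_add_of_le' hK
    have := h3 k
    simp only [Nat.add_sub_cancel] at *
    rcases h2 k with h | h <;> rw [h] at this ⊢ <;> omega
  · simp only [h3, h1]
    rcases h2 i with h | h <;> rcases h2 (K - 1) with h' | h' <;> rw [h, h'] <;>
      split_ifs with hj <;> simp only [hj, true_iff, false_iff] <;> omega

lemma exists_rightmost_min (g : ℕ → ℤ) (K : ℕ) :
    ∃ s ≤ K, ∀ i ≤ K, g s ≤ g i ∧ (s < i → g s < g i) := by
  have hex : ∃ s ≤ K, ∀ i ≤ K, g s ≤ g i := by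
    obtain ⟨s, hs, h⟩ := Finset.exists_min_image (Finset.range (K + 1)) g (by simp)
    simp only [Finset.mem_range, Nat.lt_succ_iff] at hs h
    exact ⟨s, hs, h⟩
  obtain ⟨s₀, hs₀, h₀⟩ := hex
  have hs := Nat.findGreatest_spec (P := fun s => ∀ i ≤ K, g s ≤ g i) hs₀ h₀
  refine ⟨_, Nat.findGreatest_le (P := fun s => ∀ i ≤ K, g s ≤ g i) K, fun i hi =>
    ⟨hs i hi, fun hlt => (hs i hi).lt_of_ne fun heq => ?_⟩⟩
  exact Nat.findGreatest_is_greatest hlt hi fun j hj => heq ▸ hs j hj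

lemma HasPathLabeling.reverse {J : ℕ → Prop}
    (h : HasPathLabeling a d K t fun i => J (K - i)) : HasPathLabeling a d K t J := by
  obtain ⟨h, A, h1, h2, h3, h4, h5, h6, h7, h8⟩ := h
  dsimp only at h5 h6 h7 h8
  have conv : ∀ i, i + 1 < K → K - 1 - i = K - 1 - (i + 1) + 1 ∧ K - 1 - (i + 1) + 1 < K ∧
      K - (K - 1 - (i + 1) + 1) = i + 1 := fun i hi => by omega
  refine ⟨h, fun i => A (K - 1 - i), h1, h2, ?_, fun i hi => h4 _ (by omega), ?_, ?_, ?_, ?_⟩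
  · intro i hi j hj hij
    simp only [Set.mem_Iio] at hi hj
    have := h3 (show K - 1 - i < K by omega) (show K - 1 - j < K by omega) hij
    omega
  · intro i hi hJ
    obtain ⟨e1, e2, e3⟩ := conv i hi
    have := h5 (K - 1 - (i + 1)) e2 (by rwa [e3])
    dsimp only
    rw [e1]
    tauto
  · rintro i ⟨hi, hJ⟩ j ⟨hj, hJ'⟩ hij
    obtain ⟨e1, e2, e3⟩ := conv i hi
    obtain ⟨f1, f2, f3⟩ := conv j hj
    simp only [e1, f1] at hij
    rw [mul_comm, mul_comm (aseq a d (A (K - 1 - (j + 1) + 1)))] at hij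
    have := h6 ⟨e2, by rwa [e3]⟩ ⟨f2, by rwa [f3]⟩ hij
    omega
  · intro i hi hJ
    obtain ⟨e1, e2, e3⟩ := conv i hi
    have := h7 (K - 1 - (i + 1)) e2 (by rwa [e3])
    dsimp only
    rw [e1]
    omega
  · intro i hi hJ
    obtain ⟨e1, e2, e3⟩ := conv i hi
    have := h8 (K - 1 - (i + 1)) e2 (by rwa [e3])
    dsimp only
    rw [e1, mul_comm, Nat.sub_zero, Nat.sub_self]
    exact this.symm

theorem hasPathLabeling (hK : 3 ≤ K) (ha : 1 < a) (hd : 0 < d) (t : ℕ) (J : ℕ → Prop) :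
    HasPathLabeling a d K t J := by
  obtain ⟨g, hstep, hlast, hJ⟩ := exists_walk J (show 1 ≤ K by omega)
  obtain ⟨s, hs, hmin⟩ := exists_rightmost_min g K
  have hsK : s ≠ K := by
    rintro rfl
    have := (hmin (s - 1) (by omega)).1
    omega
  by_cases hs1 : s = 1
  · subst hs1
    refine HasPathLabeling.reverse ?_
    have h : IsProfile (fun i => g (K - i)) (K - 1) K := by
      refine ⟨by omega, by omega, fun i hi => ?_, ?_, fun i hi h => ?_, fun i hi => ?_⟩
      · have := hstep (K - (i + 1))
        rw [show K - (i + 1) + 1 = K - i by omega] at this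
        omega
      · have h1 : g 1 = g 0 + 1 ∨ g 1 = g 0 - 1 := hstep 0
        have h2 := (hmin 0 (by omega)).1
        rw [Nat.sub_self, show K - (K - 1) = 1 by omega]
        omega
      · have h1 : g 1 = g 0 + 1 ∨ g 1 = g 0 - 1 := hstep 0
        have h2 := (hmin 0 (by omega)).1
        rw [show K - (K - 1) = 1 by omega, show K - i = 0 by omega]
        omega
      · rw [show K - (K - 1) = 1 by omega]
        exact (hmin _ (by omega)).1
    refine h.hasPathLabeling hK ha hd t fun i hi => ?_
    have := hJ (K - (i + 1 + 1))
    rw [show K - (i + 1 + 1) + 1 = K - (i + 1) by omega,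
      show K - (i + 1) + 1 = K - i by omega] at this
    rw [this]
    omega
  · exact IsProfile.hasPathLabeling ⟨by omega, hs1, fun i _ => hstep i, hlast,
      fun i hi h => (hmin i hi).2 h, fun i hi => (hmin i (by omega)).1⟩ hK ha hd t fun i _ => hJ i

end Existence

section Core

variable {B : Type*} [Fintype B] {p : B → ℕ} {a d : ℝ} {K : ℕ}

/-- Positive numbers can be distributed so that the weighted products over the classes of `p` are
distinct: a distribution maximizing the sum of these products does it. -/
lemma exists_equiv_prod_ne {ι : Type*} [Fintype ι] (p : B → ℕ) {c : ℕ → ℝ} (hc : ∀ i, 0 < c i)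
    {y : ι → ℝ} (hy : ∀ i, 0 < y i) (hinj : Function.Injective y)
    (hcard : Fintype.card B = Fintype.card ι) :
    ∃ e : B ≃ ι, ∀ b b', p b ≠ p b' →
      c (p b) * ∏ z with p z = p b, y (e z) ≠ c (p b') * ∏ z with p z = p b', y (e z) := by
  have : Nonempty (B ≃ ι) := ⟨Fintype.equivOfCardEq hcard⟩
  let W : (B ≃ ι) → ℕ → ℝ := fun e i => c i * ∏ z with p z = i, y (e z)
  obtain ⟨e, -, he⟩ := Finset.exists_max_image (Finset.univ : Finset (B ≃ ι))
    (fun e => ∑ i ∈ Finset.univ.image p, W e i) Finset.univ_nonempty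
  refine ⟨e, fun b b' hb heq => ?_⟩
  let e' : B ≃ ι := (Equiv.swap b b').trans e
  have hb' : b ≠ b' := fun h => hb (h ▸ rfl)
  have hW : ∀ i, 0 < W e i := fun i => mul_pos (hc i) (Finset.prod_pos fun z _ => hy _)
  have other : ∀ i, i ≠ p b → i ≠ p b' → W e' i = W e i := by
    intro i h1 h2
    refine congrArg (c i * ·) (Finset.prod_congr rfl fun z hz => ?_)
    simp only [Finset.mem_filter, Finset.mem_univ, true_and] at hz
    simp only [e', Equiv.trans_apply]
    rw [Equiv.swap_apply_of_ne_of_ne] <;> rintro rfl <;> tauto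
  have change : ∀ z z', (z = b ∧ z' = b' ∨ z = b' ∧ z' = b) →
      W e' (p z) * y (e z) = W e (p z) * y (e z') := by
    intro z z' h
    have hz : z ∈ Finset.univ.filter fun w => p w = p z := by simp
    have hez : e' z = e z' := by rcases h with ⟨rfl, rfl⟩ | ⟨rfl, rfl⟩ <;> simp [e']
    simp only [W]
    rw [← Finset.mul_prod_erase _ _ hz, ← Finset.mul_prod_erase _ _ hz, hez,
      Finset.prod_congr rfl fun w hw => ?_]
    · ring
    · simp only [Finset.mem_erase, Finset.mem_filter, Finset.mem_univ, true_and] at hw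
      simp only [e', Equiv.trans_apply]
      rw [Equiv.swap_apply_of_ne_of_ne] <;> rintro rfl <;>
        rcases h with ⟨rfl, rfl⟩ | ⟨rfl, rfl⟩ <;> tauto
  have h1 := change b b' (Or.inl ⟨rfl, rfl⟩)
  have h2 := change b' b (Or.inr ⟨rfl, rfl⟩)
  have hsum : ∑ i ∈ Finset.univ.image p, (W e' i - W e i) =
      (W e' (p b) - W e (p b)) + (W e' (p b') - W e (p b')) :=
    Finset.sum_eq_add_of_mem _ _ (by simp) (by simp) hb fun i _ hi => by
      rw [other i hi.1 hi.2, sub_self]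
  have hle := he e' (Finset.mem_univ _)
  rw [Finset.sum_sub_distrib] at hsum
  change W e (p b) = W e (p b') at heq
  rw [← heq] at h2 hsum
  have hpos := hy (e b)
  have hpos' := hy (e b')
  have hne : y (e b) ≠ y (e b') := hinj.ne (e.injective.ne hb')
  have hWb := hW (p b)
  have hsq : 0 < (y (e b) - y (e b')) ^ 2 := by positivity [sub_ne_zero.2 hne]
  have key : (W e' (p b) + W e' (p b') - 2 * W e (p b)) * (y (e b) * y (e b')) =
      W e (p b) * (y (e b) - y (e b')) ^ 2 := by
    linear_combination y (e b') * h1 + y (e b) * h2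
  have h3 : 0 < (W e' (p b) + W e' (p b') - 2 * W e (p b)) * (y (e b) * y (e b')) := by
    rw [key]; positivity
  have := (mul_pos_iff_of_pos_right (by positivity)).1 h3
  linarith

/-- The product of the labels of the path edges at the `i`-th vertex of the path. -/
def pathVal (K : ℕ) (x : ℕ → ℝ) (i : ℕ) : ℝ :=
  (if i = 0 then 1 else x (i - 1)) * (if i = K then 1 else x i)

/-- The vertex product at the `i`-th vertex of a path with `K` edges labelled by `x`, to whose
vertices pendant edges labelled by `y` are attached as prescribed by `p`. -/
noncomputable def spineVal (K : ℕ) (p : B → ℕ) (x : ℕ → ℝ) (y : B → ℝ) (i : ℕ) : ℝ :=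
  pathVal K x i * ∏ b with p b = i, y b

/-- The combinatorial form of antimagicness for the caterpillar with spine edges `0, …, K - 1` and
pendants `b` attached to the vertices `p b`. -/
def HasCaterpillarLabeling (a d : ℝ) (K : ℕ) (p : B → ℕ) : Prop :=
  ∃ (A : ℕ → ℕ) (β : B → ℕ), Set.InjOn A (Set.Iio K) ∧ Function.Injective β ∧
    (∀ i < K, ∀ b, A i ≠ β b) ∧ (∀ i < K, A i < K + Fintype.card B) ∧
    (∀ b, β b < K + Fintype.card B) ∧
    Set.InjOn (spineVal K p (fun i => aseq a d (A i)) fun b => aseq a d (β b)) (Set.Iic K) ∧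
    ∀ i ≤ K, ∀ b, spineVal K p (fun i => aseq a d (A i)) (fun b => aseq a d (β b)) i ≠
      aseq a d (β b)

lemma aseq_add_lt_mul (ha : 1 < a) (hd : 0 < d) (u v : ℕ) :
    aseq a d (u + v) < aseq a d u * aseq a d v := by
  have h1 : 0 ≤ (a - 1) * (u * d + v * d) := mul_nonneg (by linarith) (by positivity)
  have h2 : 0 ≤ (u * d) * (v * d) := by positivity
  simp only [aseq]
  push_cast
  nlinarith

lemma hasPathLabeling_two (ha : 1 < a) (hd : 0 < d) (t : ℕ) (J : ℕ → Prop) :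
    HasPathLabeling a d 2 t J := by
  refine ⟨1, fun i => if i = 0 then 0 else t + 1, le_rfl, by omega, ?_, ?_, ?_, ?_, ?_, ?_⟩
  · intro i hi j hj h
    simp only [Set.mem_Iio] at hi hj h
    split_ifs at h <;> omega
  · intro i hi
    dsimp only
    split_ifs <;> omega
  · intro i hi _
    obtain rfl : i = 0 := by omega
    simp
    omega
  · rintro i ⟨hi, -⟩ j ⟨hj, -⟩ -
    omega
  · intro i hi _
    obtain rfl : i = 0 := by omega
    simp
    omega
  · intro i hi _
    obtain rfl : i = 0 := by omega
    have h1 := one_lt_aseq ha hd 0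
    have h2 := one_lt_aseq ha hd (t + 1)
    simp only [Nat.add_eq_zero_iff, one_ne_zero, and_false, if_false, if_true, Nat.add_one_sub_one]
    constructor <;> nlinarith

lemma pathVal_zero (hK : K ≠ 0) (x : ℕ → ℝ) : pathVal K x 0 = x 0 := by
  simp [pathVal, hK.symm]

lemma pathVal_last (hK : K ≠ 0) (x : ℕ → ℝ) : pathVal K x K = x (K - 1) := by
  simp [pathVal, hK]

lemma pathVal_succ {i : ℕ} (hi : i + 1 < K) (x : ℕ → ℝ) :
    pathVal K x (i + 1) = x i * x (i + 1) := by
  simp [pathVal, hi.ne]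

lemma spineVal_of_forall_ne {x : ℕ → ℝ} {y : B → ℝ} {i : ℕ} (h : ∀ b, p b ≠ i) :
    spineVal K p x y i = pathVal K x i := by
  rw [spineVal, Finset.filter_false_of_mem fun b _ => h b, Finset.prod_empty, mul_one]

/-- Core case: all labels exceed one. -/
theorem hasCaterpillarLabeling_of_one_lt (ha : 1 < a) (hd : 0 < d) (hK : 2 ≤ K)
    (hp : ∀ b, 0 < p b ∧ p b < K) : HasCaterpillarLabeling a d K p := by
  have hpath : HasPathLabeling a d K (Fintype.card B) fun i => ∃ b, p b = i := by
    by_cases h : K = 2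
    · subst h; exact hasPathLabeling_two ha hd _ _
    · exact hasPathLabeling (by omega) ha hd _ _
  obtain ⟨h, A, hh1, hhK, hinj, hrange, hlow, hQinj, hsum, hend⟩ := hpath
  have hmono := aseq_strictMono (a := a) hd
  have hgt := one_lt_aseq ha hd
  have hpos : ∀ n, 0 < aseq a d n := fun n => one_pos.trans (hgt n)
  set x : ℕ → ℝ := fun i => aseq a d (A i) with hx
  have hpath_pos : ∀ i, 0 < pathVal K x i := fun i => by
    unfold pathVal
    have h1 : 0 < x i := hpos (A i)
    have h2 : 0 < x (i - 1) := hpos (A (i - 1))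
    split_ifs <;> positivity
  obtain ⟨e, he⟩ := exists_equiv_prod_ne p hpath_pos
    (y := fun n : Fin (Fintype.card B) => aseq a d (h + n)) (fun _ => hpos _)
    (fun n n' hn => by have := hmono.injective hn; omega) (by simp)
  set β : B → ℕ := fun b => h + e b with hβ
  set y : B → ℝ := fun b => aseq a d (β b) with hy
  have hβlt : ∀ b, h ≤ β b ∧ β b < h + Fintype.card B := fun b => by
    have := (e b).2; simp only [hβ]; omega
  have hzero : spineVal K p x y 0 = x 0 := by
    rw [spineVal_of_forall_ne fun b => (hp b).1.ne', pathVal_zero (by omega)]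
  have hlast : spineVal K p x y K = x (K - 1) := by
    rw [spineVal_of_forall_ne fun b => (hp b).2.ne, pathVal_last (by omega)]
  have hplain : ∀ i, i + 1 < K → (¬ ∃ b, p b = i + 1) →
      spineVal K p x y (i + 1) = aseq a d (A i) * aseq a d (A (i + 1)) := fun i hi hJ => by
    rw [spineVal_of_forall_ne fun b hb => hJ ⟨b, hb⟩, pathVal_succ hi]
  have hplain_lt : ∀ i, i + 1 < K → (¬ ∃ b, p b = i + 1) →
      aseq a d (h + Fintype.card B) < aseq a d (A i) * aseq a d (A (i + 1)) ∧
      aseq a d (A i) * aseq a d (A (i + 1)) ≤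
        aseq a d (h - 1) * aseq a d (K + Fintype.card B - 1) := by
    intro i hi hJ
    have key : ∀ u v, u < h → h + Fintype.card B ≤ v → v < K + Fintype.card B →
        aseq a d (h + Fintype.card B) < aseq a d u * aseq a d v ∧
        aseq a d u * aseq a d v ≤ aseq a d (h - 1) * aseq a d (K + Fintype.card B - 1) := by
      intro u v hu hv hv'
      constructor
      · have := hmono.monotone hv
        nlinarith [hgt u, hpos v]
      · exact mul_le_mul (hmono.monotone (by omega)) (hmono.monotone (by omega)) (hpos _).le
          (hpos _).le
    have h1 := hrange i (by omega)
    have h2 := hrange (i + 1) hi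
    rcases hlow i hi hJ with ⟨h3, h4⟩ | ⟨h3, h4⟩
    · exact key _ _ h3 h4 (by omega)
    · rw [mul_comm]; exact key _ _ h3 h4 (by omega)
  have hbig : ∀ b, aseq a d (K + Fintype.card B - 2) * aseq a d h < spineVal K p x y (p b) := by
    intro b
    obtain ⟨i, hi⟩ := Nat.exists_eq_succ_of_ne_zero (hp b).1.ne'
    rw [Nat.succ_eq_add_one] at hi
    have hi' : i + 1 < K := hi ▸ (hp b).2
    have h1 : aseq a d (K + Fintype.card B - 2) < pathVal K x (p b) := by
      rw [hi, pathVal_succ hi']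
      have := hsum i hi' ⟨b, hi⟩
      exact (hmono.monotone (by omega)).trans_lt (aseq_add_lt_mul ha hd _ _)
    have h2 : aseq a d h ≤ ∏ z with p z = p b, y z := by
      refine (hmono.monotone (hβlt b).1).trans ?_
      rw [← Finset.mul_prod_erase _ y (show b ∈ Finset.univ.filter fun z => p z = p b by simp)]
      exact le_mul_of_one_le_right (hpos _).le
        (Finset.one_le_prod fun z _ => (hgt (β z)).le)
    exact mul_lt_mul h1 h2 (hpos _) (hpath_pos _).le
  have hbig_label : ∀ b, ∀ n < K + Fintype.card B, aseq a d n < spineVal K p x y (p b) := by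
    intro b n hn
    refine (lt_of_le_of_lt (hmono.monotone ?_) (aseq_add_lt_mul ha hd _ _)).trans (hbig b)
    omega
  have hbig_plain : ∀ b, ∀ i, i + 1 < K → (¬ ∃ b, p b = i + 1) →
      spineVal K p x y (i + 1) < spineVal K p x y (p b) := by
    intro b i hi hJ
    rw [hplain i hi hJ]
    refine ((hplain_lt i hi hJ).2.trans ?_).trans_lt (hbig b)
    have : 0 < Fintype.card B := Fintype.card_pos_iff.2 ⟨b⟩
    by_cases hc : h ≤ K + Fintype.card B - 2
    · have := aseq_cross_lt hd ha (show h - 1 < h by omega) hc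
      rw [show K + Fintype.card B - 2 + 1 = K + Fintype.card B - 1 by omega] at this
      rw [mul_comm (aseq a d (K + Fintype.card B - 2))]
      exact this.le
    · exact (congrArg₂ (aseq a d · * aseq a d ·) (show h - 1 = K + Fintype.card B - 2 by omega)
        (show K + Fintype.card B - 1 = h by omega)).le
  have hcase : ∀ i ≤ K, i = 0 ∨ i = K ∨ (∃ b, p b = i) ∨
      ∃ j, i = j + 1 ∧ j + 1 < K ∧ ¬ ∃ b, p b = j + 1 := by
    intro i hi
    by_cases h0 : i = 0
    · exact Or.inl h0
    by_cases h1 : i = K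
    · exact Or.inr (Or.inl h1)
    by_cases h2 : ∃ b, p b = i
    · exact Or.inr (Or.inr (Or.inl h2))
    · obtain ⟨j, rfl⟩ := Nat.exists_eq_succ_of_ne_zero h0
      exact Or.inr (Or.inr (Or.inr ⟨j, rfl, by omega, h2⟩))
  have hxlt : ∀ i < K, A i < K + Fintype.card B := fun i hi => by
    have := hrange i hi
    omega
  have hβlt' : ∀ b, β b < K + Fintype.card B := fun b => by
    have := hβlt b
    omega
  have hAβ : ∀ i < K, ∀ b, A i ≠ β b := fun i hi b => by
    have := hrange i hi
    have := hβlt b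
    omega
  refine ⟨A, β, hinj, fun b b' hb => e.injective (by simp only [hβ] at hb; omega), hAβ, hxlt,
    hβlt', ?_, ?_⟩
  · have ends : A 0 ≠ A (K - 1) := fun h' => by
      have := hinj (show 0 < K by omega) (show K - 1 < K by omega) h'
      omega
    have hx0 := hxlt 0 (by omega)
    have hx1 := hxlt (K - 1) (by omega)
    intro i hi j hj hij
    rcases hcase i hi with rfl | rfl | ⟨b, rfl⟩ | ⟨i, rfl, hi', hJ⟩ <;>
      rcases hcase j hj with hj0 | hj0 | ⟨b', rfl⟩ | ⟨j, rfl, hj', hJ'⟩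
    · exact hj0.symm
    · rw [hj0, hzero, hlast] at hij
      exact absurd (hmono.injective hij) ends
    · rw [hzero] at hij
      exact absurd hij (hbig_label b' _ hx0).ne
    · rw [hzero, hplain j hj' hJ'] at hij
      exact absurd hij (hend j hj' hJ').1
    · rw [hj0, hzero, hlast] at hij
      exact absurd (hmono.injective hij).symm ends
    · exact hj0.symm
    · rw [hlast] at hij
      exact absurd hij (hbig_label b' _ hx1).ne
    · rw [hlast, hplain j hj' hJ'] at hij
      exact absurd hij (hend j hj' hJ').2
    · rw [hj0, hzero] at hij
      exact absurd hij (hbig_label b _ hx0).ne'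
    · rw [hj0, hlast] at hij
      exact absurd hij (hbig_label b _ hx1).ne'
    · by_contra hne
      exact he b b' hne hij
    · exact absurd hij (hbig_plain b j hj' hJ').ne'
    · rw [hj0, hzero, hplain i hi' hJ] at hij
      exact absurd hij.symm (hend i hi' hJ).1
    · rw [hj0, hlast, hplain i hi' hJ] at hij
      exact absurd hij.symm (hend i hi' hJ).2
    · exact absurd hij (hbig_plain b' i hi' hJ).ne
    · rw [hplain i hi' hJ, hplain j hj' hJ'] at hij
      rw [hQinj ⟨hi', hJ⟩ ⟨hj', hJ'⟩ hij]
  · intro i hi b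
    rcases hcase i hi with rfl | rfl | ⟨b', rfl⟩ | ⟨i, rfl, hi', hJ⟩
    · rw [hzero]
      exact hmono.injective.ne (hAβ 0 (by omega) b)
    · rw [hlast]
      exact hmono.injective.ne (hAβ _ (by omega) b)
    · exact (hbig_label b' _ (hβlt' b)).ne'
    · rw [hplain i hi' hJ]
      exact ((hmono (hβlt b).2).trans (hplain_lt i hi' hJ).1).ne'

end Core

section One

variable {B : Type*} [Fintype B] {p : B → ℕ} {a d : ℝ} {K : ℕ}

lemma aseq_one_succ (d : ℝ) (n : ℕ) : aseq 1 d (n + 1) = aseq (1 + d) d n := by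
  simp only [aseq]; push_cast; ring

lemma one_lt_spineVal (ha : 1 < a) (hd : 0 < d) (hK : K ≠ 0) (A : ℕ → ℕ) (β : B → ℕ) (i : ℕ) :
    1 < spineVal K p (fun i => aseq a d (A i)) (fun b => aseq a d (β b)) i := by
  have h1 := one_lt_aseq ha hd (A i)
  have h2 := one_lt_aseq ha hd (A (i - 1))
  have h3 : 1 ≤ ∏ b with p b = i, aseq a d (β b) :=
    Finset.one_le_prod fun b _ => (one_lt_aseq ha hd (β b)).le
  have h4 : 1 < pathVal K (fun i => aseq a d (A i)) i := by
    unfold pathVal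
    split_ifs <;> first | omega | nlinarith
  unfold spineVal
  nlinarith

lemma HasCaterpillarLabeling.of_subtype_ne (hd : 0 < d) (hK : K ≠ 0) (b₀ : B)
    (h : HasCaterpillarLabeling (1 + d) d K fun b : {b // b ≠ b₀} => p b) :
    HasCaterpillarLabeling 1 d K p := by
  obtain ⟨A, β, hA, hβ, hAβ, hA', hβ', hval, hval'⟩ := h
  have hcard : Fintype.card {b // b ≠ b₀} + 1 = Fintype.card B := by
    have : 0 < Fintype.card B := Fintype.card_pos_iff.2 ⟨b₀⟩
    have h1 := Fintype.card_subtype_compl (· = b₀)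
    rw [Fintype.card_subtype_eq] at h1
    change Fintype.card {b // ¬ b = b₀} + 1 = _
    omega
  let γ : B → ℕ := fun b => if h : b ≠ b₀ then β ⟨b, h⟩ + 1 else 0
  have hγ0 : γ b₀ = 0 := by simp [γ]
  have hγ : ∀ b, (h : b ≠ b₀) → γ b = β ⟨b, h⟩ + 1 := fun b h => dif_pos h
  have hspine : ∀ i, spineVal K p (fun i => aseq 1 d (A i + 1)) (fun b => aseq 1 d (γ b)) i =
      spineVal K (fun b : {b // b ≠ b₀} => p b) (fun i => aseq (1 + d) d (A i))
        (fun b => aseq (1 + d) d (β b)) i := by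
    intro i
    simp only [spineVal, aseq_one_succ, Finset.prod_filter]
    rw [Fintype.prod_eq_mul_prod_subtype_ne _ b₀, hγ0, aseq_zero, ite_self, one_mul]
    refine congrArg _ (Finset.prod_congr rfl fun b _ => ?_)
    rw [hγ b b.2, aseq_one_succ]
  refine ⟨fun i => A i + 1, γ, ?_, ?_, ?_, ?_, ?_, ?_, ?_⟩
  · exact fun i hi j hj hij => hA hi hj (Nat.succ_injective hij)
  · intro b b' hb
    by_cases h1 : b = b₀ <;> by_cases h2 : b' = b₀
    · rw [h1, h2]
    · rw [h1, hγ0, hγ b' h2] at hb; omega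
    · rw [h2, hγ0, hγ b h1] at hb; omega
    · rw [hγ b h1, hγ b' h2] at hb
      exact congrArg Subtype.val (hβ (Nat.succ_injective hb))
  · intro i hi b
    change A i + 1 ≠ γ b
    by_cases h1 : b = b₀
    · rw [h1, hγ0]; omega
    · rw [hγ b h1]
      have := hAβ i hi ⟨b, h1⟩
      omega
  · intro i hi
    change A i + 1 < K + Fintype.card B
    have := hA' i hi
    omega
  · intro b
    by_cases h1 : b = b₀
    · rw [h1, hγ0]; omega
    · rw [hγ b h1]
      have := hβ' ⟨b, h1⟩
      omega
  · intro i hi j hj hij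
    simp only [hspine] at hij
    exact hval hi hj hij
  · intro i hi b
    simp only [hspine]
    by_cases h1 : b = b₀
    · rw [h1, hγ0, aseq_zero]
      exact (one_lt_spineVal (by linarith) hd hK A β i).ne'
    · rw [hγ b h1, aseq_one_succ]
      exact hval' i hi _

lemma HasCaterpillarLabeling.of_pred [IsEmpty B] (hd : 0 < d) (hK : K ≠ 0)
    (h : HasCaterpillarLabeling (1 + d) d K p) : HasCaterpillarLabeling 1 d (K + 1) p := by
  obtain ⟨A, β, hA, -, -, hA', -, hval, -⟩ := h
  let C : ℕ → ℕ := fun i => if i = K then 0 else A i + 1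
  have hC : ∀ i, i ≠ K → C i = A i + 1 := fun i hi => if_neg hi
  have hCK : C K = 0 := if_pos rfl
  have hspine : ∀ i ≤ K, spineVal (K + 1) p (fun i => aseq 1 d (C i)) (fun b => aseq 1 d (β b)) i =
      spineVal K p (fun i => aseq (1 + d) d (A i)) (fun b => aseq (1 + d) d (β b)) i := by
    intro i hi
    have h1 : i ≠ 0 → aseq 1 d (C (i - 1)) = aseq (1 + d) d (A (i - 1)) := fun h => by
      rw [hC _ (by omega), aseq_one_succ]
    have h2 : i ≠ K → aseq 1 d (C i) = aseq (1 + d) d (A i) := fun h => by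
      rw [hC _ h, aseq_one_succ]
    simp only [spineVal, pathVal, Finset.univ_eq_empty, Finset.filter_empty, Finset.prod_empty,
      show i ≠ K + 1 by omega, if_false]
    by_cases h0 : i = 0 <;> by_cases hK' : i = K
    · omega
    · rw [if_pos h0, if_neg hK', if_pos h0, h2 hK']
    · rw [if_neg h0, if_neg h0, h1 h0, hK', hCK, if_pos rfl, aseq_zero]
    · rw [if_neg h0, if_neg h0, if_neg hK', h1 h0, h2 hK']
  have hlast : spineVal (K + 1) p (fun i => aseq 1 d (C i)) (fun b => aseq 1 d (β b)) (K + 1) =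
      1 := by
    simp [spineVal, pathVal, hCK, aseq_zero]
  refine ⟨C, β, ?_, Function.injective_of_subsingleton β, fun _ _ b => isEmptyElim b, ?_,
    fun b => isEmptyElim b, ?_, fun _ _ b => isEmptyElim b⟩
  · intro i hi j hj hij
    simp only [Set.mem_Iio] at hi hj
    by_cases h1 : i = K <;> by_cases h2 : j = K
    · rw [h1, h2]
    · rw [h1, hCK, hC j h2] at hij; omega
    · rw [h2, hCK, hC i h1] at hij; omega
    · rw [hC i h1, hC j h2] at hij
      exact hA (show i < K by omega) (show j < K by omega) (Nat.succ_injective hij)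
  · intro i hi
    by_cases h1 : i = K
    · rw [h1, hCK]; omega
    · rw [hC i h1]
      have := hA' i (by omega)
      omega
  · intro i hi j hj hij
    simp only [Set.mem_Iic] at hi hj
    by_cases h1 : i = K + 1 <;> by_cases h2 : j = K + 1
    · rw [h1, h2]
    · rw [h1, hlast, hspine j (by omega)] at hij
      exact absurd hij (one_lt_spineVal (by linarith) hd hK A β j).ne
    · rw [h2, hlast, hspine i (by omega)] at hij
      exact absurd hij (one_lt_spineVal (by linarith) hd hK A β i).ne'
    · rw [hspine i (by omega), hspine j (by omega)] at hij
      exact hval (show i ≤ K by omega) (show j ≤ K by omega) hij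

theorem hasCaterpillarLabeling (ha : 1 ≤ a) (hd : 0 < d) (hK : 2 ≤ K)
    (hm : 3 ≤ K + Fintype.card B) (hp : ∀ b, 0 < p b ∧ p b < K) :
    HasCaterpillarLabeling a d K p := by
  rcases ha.lt_or_eq with ha | rfl
  · exact hasCaterpillarLabeling_of_one_lt ha hd hK hp
  · rcases isEmpty_or_nonempty B with hB | ⟨⟨b₀⟩⟩
    · rw [Fintype.card_eq_zero] at hm
      obtain ⟨k, rfl⟩ : ∃ k, K = k + 1 := ⟨K - 1, by omega⟩
      exact .of_pred hd (by omega)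
        (hasCaterpillarLabeling_of_one_lt (by linarith) hd (by omega) fun b => isEmptyElim b)
    · exact .of_subtype_ne hd (by omega) b₀
        (hasCaterpillarLabeling_of_one_lt (by linarith) hd hK fun b => hp b)

end One

section Spine

variable {V : Type*} [Fintype V] {T : SimpleGraph V}

lemma mem_edgeFS {G : SimpleGraph V} {e : Sym2 V} : e ∈ edgeFS G ↔ e ∈ G.edgeSet := by
  simp [edgeFS]

lemma card_edgeFS (hT : T.IsTree) : (edgeFS T).card + 1 = Fintype.card V :=
  hT.card_edgeFinset

lemma eq_of_adj_of_degree_eq_one {v x y : V} (hv : T.degree v = 1) (hx : T.Adj v x)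
    (hy : T.Adj v y) : x = y := by
  rw [← SimpleGraph.card_neighborFinset_eq_degree, Finset.card_eq_one] at hv
  obtain ⟨z, hz⟩ := hv
  have h1 : x ∈ T.neighborFinset v := by simpa using hx
  have h2 : y ∈ T.neighborFinset v := by simpa using hy
  rw [hz, Finset.mem_singleton] at h1 h2
  rw [h1, h2]

lemma exists_adj (hT : T.IsTree) (hm : 3 ≤ (edgeFS T).card) (v : V) : ∃ x, T.Adj v x := by
  have := card_edgeFS hT
  have : Nontrivial V := Fintype.one_lt_card_iff_nontrivial.1 (by omega)
  have := hT.1.preconnected.degree_pos_of_nontrivial v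
  exact (T.degree_pos_iff_exists_adj v).1 this

/-- In a tree with at least two edges no two leaves are adjacent. -/
lemma degree_ne_one_of_adj (hT : T.IsTree) (hm : 3 ≤ (edgeFS T).card) {v x : V}
    (hv : T.degree v = 1) (h : T.Adj v x) : T.degree x ≠ 1 := by
  intro hx
  have hwalk : ∀ {y z : V}, T.Walk y z → (y = v ∨ y = x) → (z = v ∨ z = x) := by
    intro y z w
    induction w with
    | nil => exact id
    | cons hadj _ ih =>
      rintro (rfl | rfl)
      · exact ih (Or.inr (eq_of_adj_of_degree_eq_one hv hadj h))
      · exact ih (Or.inl (eq_of_adj_of_degree_eq_one hx hadj h.symm))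
  have hsub : (Finset.univ : Finset V) ⊆ {v, x} := fun z _ => by
    obtain ⟨w⟩ := hT.1.preconnected v z
    simpa using hwalk w (Or.inl rfl)
  have h1 := Finset.card_le_card hsub
  have h2 := Finset.card_le_two (a := v) (b := x)
  have h3 := card_edgeFS hT
  rw [Finset.card_univ] at h1
  omega

/-- The spine of a caterpillar with the leaves removed, with a leaf attached to each end. -/
lemma exists_ends (hT : T.IsTree) (hm : 3 ≤ (edgeFS T).card) {k : ℕ} {w : ℕ → V} (hk : 1 ≤ k)
    (hinj : ∀ i < k, ∀ j < k, w i = w j → i = j)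
    (hdeg : ∀ v, T.degree v ≠ 1 ↔ ∃ j < k, w j = v)
    (hadj : ∀ i < k, ∀ j < k, T.Adj (w i) (w j) ↔ i + 1 = j ∨ j + 1 = i) :
    ∃ z z', z ≠ z' ∧ T.degree z = 1 ∧ T.degree z' = 1 ∧ T.Adj z (w 0) ∧ T.Adj (w (k - 1)) z' := by
  have leaf : ∀ i < k, ∀ j, (∀ j' < k, i + 1 = j' ∨ j' + 1 = i → j' = j) →
      ∃ z, T.Adj (w i) z ∧ T.degree z = 1 := by
    intro i hi j hj
    obtain ⟨x, hx⟩ := exists_adj hT hm (w i)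
    have hcard : T.degree (w i) ≠ 1 := (hdeg _).2 ⟨i, hi, rfl⟩
    by_contra! hcon
    refine hcard ?_
    have hall : ∀ z, T.Adj (w i) z → z = w j := by
      intro z hz
      obtain ⟨j', hj', rfl⟩ := (hdeg z).1 (hcon z hz)
      rw [hj j' hj' ((hadj i hi j' hj').1 hz)]
    rw [← SimpleGraph.card_neighborFinset_eq_degree, Finset.card_eq_one]
    refine ⟨w j, Finset.eq_singleton_iff_unique_mem.2 ⟨?_, fun z hz => hall z (by simpa using hz)⟩⟩
    simpa [← hall x hx] using hx
  by_cases hk1 : k = 1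
  · subst hk1
    have hnbr : ∀ z, z ≠ w 0 → T.degree z = 1 ∧ T.Adj z (w 0) := by
      intro z hz
      have hz1 : T.degree z = 1 := by
        by_contra hd
        obtain ⟨j, hj, rfl⟩ := (hdeg z).1 hd
        exact hz (by rw [show j = 0 by omega])
      obtain ⟨x, hx⟩ := exists_adj hT hm z
      obtain ⟨j, hj, rfl⟩ := (hdeg x).1 (degree_ne_one_of_adj hT hm hz1 hx)
      rw [show j = 0 by omega] at hx
      exact ⟨hz1, hx⟩
    have hcard : 1 < (Finset.univ.erase (w 0)).card := by
      have := card_edgeFS hT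
      rw [Finset.card_erase_of_mem (Finset.mem_univ _), Finset.card_univ]
      omega
    obtain ⟨z, hz, z', hz', hne⟩ := Finset.one_lt_card.1 hcard
    obtain ⟨h1, h2⟩ := hnbr z (Finset.ne_of_mem_erase hz)
    obtain ⟨h3, h4⟩ := hnbr z' (Finset.ne_of_mem_erase hz')
    exact ⟨z, z', hne, h1, h3, h2, h4.symm⟩
  · obtain ⟨z, hz, hz1⟩ := leaf 0 (by omega) 1 (by omega)
    obtain ⟨z', hz', hz1'⟩ := leaf (k - 1) (by omega) (k - 2) (by omega)
    refine ⟨z, z', ?_, hz1, hz1', hz.symm, hz'⟩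
    rintro rfl
    have heq := eq_of_adj_of_degree_eq_one hz1 hz.symm hz'.symm
    have := hinj 0 (by omega) (k - 1) (by omega) heq
    omega

lemma IsCaterpillar.exists_spine (hT : IsCaterpillar T) (hm : 3 ≤ (edgeFS T).card) :
    ∃ (K : ℕ) (u : ℕ → V), 2 ≤ K ∧ Set.InjOn u (Set.Iic K) ∧
      (∀ i < K, T.Adj (u i) (u (i + 1))) ∧
      ∀ v, (∀ i ≤ K, u i ≠ v) → ∃ j, 0 < j ∧ j < K ∧ T.Adj v (u j) := by
  obtain ⟨hT, k, ⟨f⟩⟩ := hT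
  obtain ⟨v₀⟩ : Nonempty V := hT.1.nonempty
  have hk : 1 ≤ k := by
    obtain ⟨x, hx⟩ := exists_adj hT hm v₀
    have : ∃ v, T.degree v ≠ 1 := by
      by_cases h : T.degree v₀ = 1
      · exact ⟨x, degree_ne_one_of_adj hT hm h hx⟩
      · exact ⟨v₀, h⟩
    obtain ⟨v, hv⟩ := this
    have := (f ⟨v, hv⟩).2
    omega
  let w : ℕ → V := fun j => if h : j < k then (f.symm ⟨j, h⟩).1 else v₀
  have hw : ∀ j, (h : j < k) → w j = (f.symm ⟨j, h⟩).1 := fun j h => dif_pos h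
  have hwinj : ∀ i < k, ∀ j < k, w i = w j → i = j := by
    intro i hi j hj hij
    rw [hw i hi, hw j hj] at hij
    simpa using f.symm.injective (Subtype.ext hij)
  have hdeg : ∀ v, T.degree v ≠ 1 ↔ ∃ j < k, w j = v := by
    intro v
    constructor
    · intro hv
      refine ⟨f ⟨v, hv⟩, (f ⟨v, hv⟩).2, ?_⟩
      rw [hw _ (f ⟨v, hv⟩).2]
      simp
    · rintro ⟨j, hj, rfl⟩
      rw [hw j hj]
      exact (f.symm ⟨j, hj⟩).2
  have hadj : ∀ i < k, ∀ j < k, T.Adj (w i) (w j) ↔ i + 1 = j ∨ j + 1 = i := by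
    intro i hi j hj
    rw [hw i hi, hw j hj]
    have := f.symm.map_adj_iff (v := ⟨i, hi⟩) (w := ⟨j, hj⟩)
    rw [SimpleGraph.pathGraph_adj] at this
    exact this
  obtain ⟨z, z', hne, hz, hz', haz, haz'⟩ := exists_ends hT hm hk hwinj hdeg hadj
  have hwne : ∀ j < k, w j ≠ z ∧ w j ≠ z' := fun j hj => by
    have := (hdeg (w j)).2 ⟨j, hj, rfl⟩
    constructor <;> rintro rfl <;> contradiction
  let u : ℕ → V := fun i => if i = 0 then z else if i ≤ k then w (i - 1) else z'
  have hu0 : u 0 = z := rfl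
  have hu : ∀ j < k, u (j + 1) = w j := fun j hj => by simp [u, Nat.succ_le_of_lt hj]
  have hulast : u (k + 1) = z' := by simp [u]
  refine ⟨k + 1, u, by omega, ?_, ?_, ?_⟩
  · have hcase : ∀ i ≤ k + 1, i = 0 ∨ i = k + 1 ∨ ∃ j < k, i = j + 1 := fun i hi => by
      by_cases h : i = 0 ∨ i = k + 1
      · tauto
      · exact Or.inr (Or.inr ⟨i - 1, by omega, by omega⟩)
    intro i hi j hj hij
    rcases hcase i hi with rfl | rfl | ⟨i, hi', rfl⟩ <;>
      rcases hcase j hj with rfl | rfl | ⟨j, hj', rfl⟩ <;>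
      try simp only [hu0, hulast] at hij
    · rfl
    · exact absurd hij hne
    · rw [hu j hj'] at hij
      exact absurd hij.symm (hwne j hj').1
    · exact absurd hij.symm hne
    · rfl
    · rw [hu j hj'] at hij
      exact absurd hij.symm (hwne j hj').2
    · rw [hu i hi'] at hij
      exact absurd hij (hwne i hi').1
    · rw [hu i hi'] at hij
      exact absurd hij (hwne i hi').2
    · rw [hu i hi', hu j hj'] at hij
      rw [hwinj i hi' j hj' hij]
  · intro i hi
    rcases Nat.eq_zero_or_pos i with rfl | hi0
    · rw [hu0, hu 0 hk]
      exact haz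
    · obtain ⟨j, rfl⟩ : ∃ j, i = j + 1 := ⟨i - 1, by omega⟩
      rw [hu j (by omega)]
      by_cases hj : j + 1 = k
      · rw [hj, hulast, show j = k - 1 by omega]
        exact haz'
      · rw [hu (j + 1) (by omega)]
        exact (hadj _ (by omega) _ (by omega)).2 (Or.inl rfl)
  · intro v hv
    have hv1 : T.degree v = 1 := by
      by_contra hd
      obtain ⟨j, hj, rfl⟩ := (hdeg v).1 hd
      exact hv (j + 1) (by omega) (hu j hj)
    obtain ⟨x, hx⟩ := exists_adj hT hm v
    obtain ⟨j, hj, rfl⟩ := (hdeg x).1 (degree_ne_one_of_adj hT hm hv1 hx)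
    exact ⟨j + 1, by omega, by omega, by rwa [hu j hj]⟩

end Spine

section Tree

variable {V : Type*} {K : ℕ} {u : ℕ → V}

/-- The edges of a caterpillar: those between consecutive spine vertices, and the pendants. -/
def spineEdge (K : ℕ) (u : ℕ → V) (p : {v // ∀ i ≤ K, u i ≠ v} → ℕ) :
    Fin K ⊕ {v // ∀ i ≤ K, u i ≠ v} → Sym2 V :=
  Sum.elim (fun i => s(u i, u (i + 1))) fun b => s(b.1, u (p b))

variable {p : {v // ∀ i ≤ K, u i ≠ v} → ℕ}

lemma mem_spineEdge_inl (hu : Set.InjOn u (Set.Iic K)) {j : ℕ} (hj : j ≤ K) (i : Fin K) :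
    u j ∈ spineEdge K u p (Sum.inl i) ↔ (i : ℕ) = j ∨ (i : ℕ) + 1 = j := by
  have hi := i.2
  simp only [spineEdge, Sum.elim_inl, Sym2.mem_iff]
  rw [hu.eq_iff hj (show (i : ℕ) ≤ K by omega), hu.eq_iff hj (show (i : ℕ) + 1 ≤ K by omega)]
  omega

lemma mem_spineEdge_inr (hu : Set.InjOn u (Set.Iic K)) (hp : ∀ b, 0 < p b ∧ p b < K) {j : ℕ}
    (hj : j ≤ K) (b : {v // ∀ i ≤ K, u i ≠ v}) :
    u j ∈ spineEdge K u p (Sum.inr b) ↔ p b = j := by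
  simp only [spineEdge, Sum.elim_inr, Sym2.mem_iff, b.2 j hj, false_or]
  rw [hu.eq_iff hj (hp b).2.le, eq_comm]

lemma not_mem_spineEdge_inl (b : {v // ∀ i ≤ K, u i ≠ v}) (i : Fin K) :
    b.1 ∉ spineEdge K u p (Sum.inl i) := by
  have hi := i.2
  simp only [spineEdge, Sum.elim_inl, Sym2.mem_iff, not_or]
  exact ⟨(b.2 i (by omega)).symm, (b.2 (i + 1) (by omega)).symm⟩

lemma mem_spineEdge_inr_self (hp : ∀ b, 0 < p b ∧ p b < K) (b b' : {v // ∀ i ≤ K, u i ≠ v}) :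
    b.1 ∈ spineEdge K u p (Sum.inr b') ↔ b' = b := by
  simp only [spineEdge, Sum.elim_inr, Sym2.mem_iff, (b.2 (p b') (hp b').2.le).symm, or_false]
  rw [Subtype.coe_inj, eq_comm]

lemma spineEdge_injective (hu : Set.InjOn u (Set.Iic K)) (hp : ∀ b, 0 < p b ∧ p b < K) :
    Function.Injective (spineEdge K u p) := by
  have key : ∀ (i : Fin K) b, spineEdge K u p (Sum.inl i) ≠ spineEdge K u p (Sum.inr b) := by
    intro i b h
    exact not_mem_spineEdge_inl (p := p) b i (h ▸ (mem_spineEdge_inr_self hp b b).2 rfl)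
  rintro (i | b) (j | b') h
  · have hi := i.2
    have hj := j.2
    have h1 : ∀ n ≤ K, ((i : ℕ) = n ∨ (i : ℕ) + 1 = n) ↔ ((j : ℕ) = n ∨ (j : ℕ) + 1 = n) :=
      fun n hn => by rw [← mem_spineEdge_inl (p := p) hu hn, ← mem_spineEdge_inl (p := p) hu hn, h]
    have h2 := h1 i (by omega)
    have h3 := h1 (i + 1) (by omega)
    exact congrArg Sum.inl (Fin.ext (by omega))
  · exact absurd h (key i b')
  · exact absurd h.symm (key j b)
  · rw [(mem_spineEdge_inr_self hp b b').1 (h ▸ (mem_spineEdge_inr_self hp b b).2 rfl)]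

variable [Fintype V] {T : SimpleGraph V}

lemma edgeFS_eq_image (hT : T.IsTree) (hu : Set.InjOn u (Set.Iic K))
    (hadj : ∀ i < K, T.Adj (u i) (u (i + 1))) (hp : ∀ b, 0 < p b ∧ p b < K)
    (hpadj : ∀ b, T.Adj b.1 (u (p b))) : edgeFS T = Finset.univ.image (spineEdge K u p) := by
  refine (Finset.eq_of_subset_of_card_le ?_ ?_).symm
  · intro e he
    obtain ⟨c, -, rfl⟩ := Finset.mem_image.1 he
    rw [mem_edgeFS]
    rcases c with i | b
    · exact hadj i i.2
    · exact hpadj b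
  · rw [Finset.card_image_of_injective _ (spineEdge_injective hu hp), Finset.card_univ,
      Fintype.card_sum, Fintype.card_fin]
    have hsurj : Function.Surjective
        (Sum.elim (fun i : Fin (K + 1) => u i) fun b : {v // ∀ i ≤ K, u i ≠ v} => b.1) := by
      intro v
      by_cases hv : ∀ i ≤ K, u i ≠ v
      · exact ⟨Sum.inr ⟨v, hv⟩, rfl⟩
      · push Not at hv
        obtain ⟨i, hi, rfl⟩ := hv
        exact ⟨Sum.inl ⟨i, by omega⟩, rfl⟩
    have h1 := Fintype.card_le_of_surjective _ hsurj
    rw [Fintype.card_sum, Fintype.card_fin] at h1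
    have h2 := card_edgeFS hT
    omega

lemma prod_incident_eq_pathVal (x : ℕ → ℝ) {j : ℕ} (hj : j ≤ K) :
    ∏ i : Fin K, (if (i : ℕ) = j ∨ (i : ℕ) + 1 = j then x i else 1) = pathVal K x j := by
  rw [Fin.prod_univ_eq_prod_range (fun i => if i = j ∨ i + 1 = j then x i else 1)]
  have hsplit : ∀ i ∈ Finset.range K, (if i = j ∨ i + 1 = j then x i else 1) =
      (if j = i then x i else 1) * if j = i + 1 then x i else 1 := fun i _ => by
    split_ifs <;> first | omega | simp
  rw [Finset.prod_congr rfl hsplit, Finset.prod_mul_distrib, Finset.prod_ite_eq, mul_comm]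
  unfold pathVal
  congr 1
  · rcases Nat.eq_zero_or_pos j with rfl | h
    · exact Finset.prod_eq_one fun i _ => if_neg (by omega)
    · obtain ⟨i, rfl⟩ : ∃ i, j = i + 1 := ⟨j - 1, by omega⟩
      have : ∀ n ∈ Finset.range K, (if i + 1 = n + 1 then x n else 1) = if i = n then x n else 1 :=
        fun n _ => by simp
      rw [Finset.prod_congr rfl this, Finset.prod_ite_eq, if_pos (by simp; omega),
          if_neg (by omega)]
      rfl
  · by_cases h : j = K
    · simp [h]
    · rw [if_pos (by simp; omega), if_neg h]

theorem IsCaterpillar.arithProdAntimagic (hT : IsCaterpillar T) (hm : 3 ≤ (edgeFS T).card) :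
    ArithProdAntimagic T := by
  intro a d ha hd
  obtain ⟨K, u, hK, hu, hadj, hex⟩ := hT.exists_spine hm
  choose p hp0 hpK hpadj using fun b : {v // ∀ i ≤ K, u i ≠ v} => hex b.1 b.2
  have hp : ∀ b, 0 < p b ∧ p b < K := fun b => ⟨hp0 b, hpK b⟩
  have hε := spineEdge_injective hu hp
  have himage := edgeFS_eq_image hT.1 hu hadj hp hpadj
  have hcard : (edgeFS T).card = K + Fintype.card {v // ∀ i ≤ K, u i ≠ v} := by
    rw [himage, Finset.card_image_of_injective _ hε, Finset.card_univ, Fintype.card_sum,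
      Fintype.card_fin]
  obtain ⟨A, β, hA, hβ, hAβ, hA', hβ', hval, hval'⟩ :=
    hasCaterpillarLabeling ha hd hK (hcard ▸ hm) hp
  let ν : Fin K ⊕ {v // ∀ i ≤ K, u i ≠ v} → ℕ := Sum.elim (fun i => A i) β
  have hν : Function.Injective ν := by
    rintro (i | b) (j | b') h
    · exact congrArg Sum.inl (Fin.ext (hA i.2 j.2 h))
    · exact absurd h (hAβ i i.2 b')
    · exact absurd h.symm (hAβ j j.2 b)
    · exact congrArg Sum.inr (hβ h)
  have hνlt : ∀ c, ν c < (edgeFS T).card := by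
    rw [hcard]
    rintro (i | b)
    · exact hA' i i.2
    · exact hβ' b
  let φ : Sym2 V → ℝ := Function.extend (spineEdge K u p) (fun c => aseq a d (ν c)) 0
  have hφ : ∀ c, φ (spineEdge K u p c) = aseq a d (ν c) := hε.extend_apply _ _
  have hprod : ∀ v, vProd T φ v =
      (∏ i : Fin K, if v ∈ spineEdge K u p (Sum.inl i) then aseq a d (A i) else 1) *
        ∏ b, if v ∈ spineEdge K u p (Sum.inr b) then aseq a d (β b) else 1 := by
    intro v
    rw [vProd, himage, Finset.prod_filter, Finset.prod_image hε.injOn, Fintype.prod_sum_type]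
    simp only [hφ]
    rfl
  have hspine : ∀ j ≤ K, vProd T φ (u j) =
      spineVal K p (fun i => aseq a d (A i)) (fun b => aseq a d (β b)) j := by
    intro j hj
    rw [hprod, spineVal, ← prod_incident_eq_pathVal _ hj, Finset.prod_filter]
    simp only [mem_spineEdge_inl hu hj, mem_spineEdge_inr hu hp hj]
  have hpend : ∀ b : {v // ∀ i ≤ K, u i ≠ v}, vProd T φ b.1 = aseq a d (β b) := by
    intro b
    rw [hprod]
    simp [not_mem_spineEdge_inl, mem_spineEdge_inr_self hp]
  have hmono := aseq_strictMono (a := a) hd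
  refine ⟨φ, ?_, ?_⟩
  · have hmaps : Set.MapsTo φ ↑(edgeFS T)
        ↑((Finset.range (edgeFS T).card).image fun i : ℕ => a + (i : ℝ) * d) := by
      intro e he
      rw [Finset.mem_coe, himage] at he
      obtain ⟨c, -, rfl⟩ := Finset.mem_image.1 he
      rw [hφ, Finset.mem_coe, Finset.mem_image]
      exact ⟨ν c, Finset.mem_range.2 (hνlt c), rfl⟩
    have hinj : Set.InjOn φ ↑(edgeFS T) := by
      intro e he e' he' h
      rw [Finset.mem_coe, himage] at he he'
      obtain ⟨c, -, rfl⟩ := Finset.mem_image.1 he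
      obtain ⟨c', -, rfl⟩ := Finset.mem_image.1 he'
      rw [hφ, hφ] at h
      rw [hν (hmono.injective h)]
    exact ⟨hmaps, hinj, Finset.surjOn_of_injOn_of_card_le φ hmaps hinj
      (Finset.card_image_le.trans (Finset.card_range _).le)⟩
  · have hcase : ∀ v, (∃ j ≤ K, u j = v) ∨ ∃ b : {v // ∀ i ≤ K, u i ≠ v}, b.1 = v := by
      intro v
      by_cases hv : ∃ j ≤ K, u j = v
      · exact Or.inl hv
      · push Not at hv
        exact Or.inr ⟨⟨v, hv⟩, rfl⟩
    intro v v' h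
    rcases hcase v with ⟨j, hj, rfl⟩ | ⟨b, rfl⟩ <;> rcases hcase v' with ⟨j', hj', rfl⟩ | ⟨b', rfl⟩
    · rw [hspine j hj, hspine j' hj'] at h
      rw [hval hj hj' h]
    · rw [hspine j hj, hpend] at h
      exact absurd h (hval' j hj b')
    · rw [hspine j' hj', hpend] at h
      exact absurd h.symm (hval' j' hj' b)
    · rw [hpend, hpend] at h
      rw [hβ (hmono.injective h)]

end Tree

/-- Every caterpillar with at least three edges is arithmetic product
antimagic. -/
theorem stmt_17 {V : Type*} [Fintype V] (T : SimpleGraph V) (hT : IsCaterpillar T)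
    (hm : 3 ≤ (edgeFS T).card) :
    ArithProdAntimagic T := by
  exact hT.arithProdAntimagic hm
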